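/- Fix r ∈ ℕ and let i ∈ {1, 2}. Then Σ_{n ≤ x} Λ(n) f_i(n) = r x (1 + O(1/log x)) as x → ∞. -/

import Mathlib

open Filter Finset

/-- `τ_r(n)`, the `r`-th divisor function: the number of ordered `r`-tuples of positive
integers whose product is `n`; equivalently the coefficient of `n^{-s}` in `ζ(s)^r`. -/
noncomputable def tauR (r n : ℕ) : ℕ := (ArithmeticFunction.zeta ^ r : ArithmeticFunction ℕ) n

/-- The multiplicative function `f₁` determined on prime powers by
`f₁(p^e) = (Σ_{j≥0} τ_r(p^{e+j})/p^j) / (Σ_{j≥0} τ_r(p^j)/p^j)`. -/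
noncomputable def fOne (r n : ℕ) : ℝ :=
  ∏ p ∈ n.primeFactors,
    (∑' j : ℕ, (tauR r (p ^ (n.factorization p + j)) : ℝ) / p ^ j) /
      (∑' j : ℕ, (tauR r (p ^ j) : ℝ) / p ^ j)

/-- The multiplicative function `f₂` determined on prime powers by
`f₂(p^e) = (Σ_{j≥0} τ_r(p^{e+j}) τ_r(p^j)/p^j) / (Σ_{j≥0} τ_r(p^j)²/p^j)`. -/
noncomputable def fTwo (r n : ℕ) : ℝ :=
  ∏ p ∈ n.primeFactors,
    (∑' j : ℕ, ((tauR r (p ^ (n.factorization p + j)) : ℝ) * tauR r (p ^ j)) / p ^ j) /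
      (∑' j : ℕ, ((tauR r (p ^ j) : ℝ)) ^ 2 / p ^ j)

/-- The `n`-th term of the series expressing `(s - 1) ζ(s) - 1`. -/
noncomputable def zetaTerm (n : ℕ) (s : ℂ) : ℂ :=
  (s - 1) * ((n + 1 : ℝ) : ℂ) ^ (-s) + ((n + 2 : ℝ) : ℂ) ^ (1 - s) - ((n + 1 : ℝ) : ℂ) ^ (1 - s)

/-- The function `(s - 1) ζ(s)`, continued to `re s > 59 / 60`. -/
noncomputable def zetaReg (s : ℂ) : ℂ := 1 + ∑' n : ℕ, zetaTerm n s

lemma hasDerivAt_ofReal_cpow' (r : ℂ) {u : ℝ} (hu : 0 < u) :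
    HasDerivAt (fun y : ℝ => (y : ℂ) ^ r) (r * (u : ℂ) ^ (r - 1)) u := by
  have h : HasDerivAt (fun y : ℂ => y ^ r) (r * (u : ℂ) ^ (r - 1) * 1) (u : ℂ) :=
    (hasDerivAt_id (u : ℂ)).cpow_const (Complex.ofReal_mem_slitPlane.2 hu)
  simpa using h.comp_ofReal

lemma norm_cpow_sub_cpow_le {m u : ℝ} (hm : 1 ≤ m) (hu : u ∈ Set.Icc m (m + 1)) {s : ℂ}
    (hs : 0 < s.re) :
    ‖(m : ℂ) ^ (-s) - (u : ℂ) ^ (-s)‖ ≤ 2 * ‖s‖ ^ (1 / 30 : ℝ) * m ^ (-s.re - 1 / 30) := by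
  have hm0 : 0 < m := by linarith
  have hu0 : 0 < u := hm0.trans_le hu.1
  have hns : 0 < ‖s‖ := norm_pos_iff.2 (by rintro rfl; simp at hs)
  have h1 : ‖(m : ℂ) ^ (-s) - (u : ℂ) ^ (-s)‖ ≤ 2 * m ^ (-s.re) := by
    refine (norm_sub_le _ _).trans ?_
    rw [Complex.norm_cpow_eq_rpow_re_of_pos hm0, Complex.norm_cpow_eq_rpow_re_of_pos hu0,
      Complex.neg_re]
    have := Real.rpow_le_rpow_of_nonpos hm0 hu.1 (by linarith : -s.re ≤ 0)
    linarith
  have h2 : ‖(m : ℂ) ^ (-s) - (u : ℂ) ^ (-s)‖ ≤ ‖s‖ * m ^ (-s.re - 1) := by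
    rw [norm_sub_rev]
    have h := norm_image_sub_le_of_norm_deriv_le_segment'
      (f := fun y : ℝ => (y : ℂ) ^ (-s)) (a := m) (b := m + 1) (C := ‖s‖ * m ^ (-s.re - 1))
      (fun x hx => (hasDerivAt_ofReal_cpow' (-s) (hm0.trans_le hx.1)).hasDerivWithinAt)
      (fun x hx => by
        have hx0 : 0 < x := hm0.trans_le hx.1
        rw [norm_mul, norm_neg, Complex.norm_cpow_eq_rpow_re_of_pos hx0]
        simp only [Complex.sub_re, Complex.neg_re, Complex.one_re]
        exact mul_le_mul_of_nonneg_left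
          (Real.rpow_le_rpow_of_nonpos hm0 hx.1 (by linarith)) hns.le) u hu
    refine h.trans (mul_le_of_le_one_right (by positivity) (by linarith [hu.2]))
  have h3 : m ^ (-s.re - 1 / 30) = m ^ (-s.re) * m ^ (-(1 / 30) : ℝ) := by
    rw [← Real.rpow_add hm0]; congr 1
  have h4 : m ^ (-s.re - 1) = m ^ (-s.re) * m⁻¹ := by
    rw [← Real.rpow_neg_one, ← Real.rpow_add hm0]; congr 1
  have hP : 0 < m ^ (-s.re) := by positivity
  rw [h3]
  rw [h4] at h2
  have h5 : ‖s‖ ^ (1 / 30 : ℝ) * m ^ (-(1 / 30) : ℝ) = (‖s‖ / m) ^ (1 / 30 : ℝ) := by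
    rw [Real.div_rpow hns.le hm0.le, Real.rpow_neg hm0.le]; rfl
  have h6 : 2 * ‖s‖ ^ (1 / 30 : ℝ) * (m ^ (-s.re) * m ^ (-(1 / 30) : ℝ))
      = 2 * m ^ (-s.re) * (‖s‖ / m) ^ (1 / 30 : ℝ) := by rw [← h5]; ring
  rw [h6]
  rcases le_total 1 (‖s‖ / m) with h | h
  · exact h1.trans (le_mul_of_one_le_right (by positivity) (Real.one_le_rpow h (by norm_num)))
  · have := Real.rpow_le_rpow_of_exponent_ge (by positivity) h (by norm_num : (1 / 30 : ℝ) ≤ 1)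
    rw [Real.rpow_one] at this
    calc _ ≤ m ^ (-s.re) * (‖s‖ / m) := by rw [div_eq_mul_inv]; linarith
      _ ≤ m ^ (-s.re) * (‖s‖ / m) ^ (1 / 30 : ℝ) := by gcongr
      _ ≤ _ := by rw [mul_assoc]; exact le_mul_of_one_le_left (by positivity) (by norm_num)

lemma norm_zetaTerm_le (n : ℕ) {s : ℂ} (hs : 0 < s.re) :
    ‖zetaTerm n s‖ ≤
      ‖s - 1‖ * (2 * ‖s‖ ^ (1 / 30 : ℝ)) * (n + 1 : ℝ) ^ (-s.re - 1 / 30) := by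
  set m : ℝ := n + 1 with hm
  have hm1 : 1 ≤ m := by simp [hm]
  have hm0 : 0 < m := by linarith
  have h := norm_image_sub_le_of_norm_deriv_le_segment'
      (f := fun y : ℝ => (s - 1) * (m : ℂ) ^ (-s) * (y : ℂ) + (y : ℂ) ^ (1 - s))
      (f' := fun y : ℝ => (s - 1) * (m : ℂ) ^ (-s) * 1 + (1 - s) * (y : ℂ) ^ (1 - s - 1))
      (a := m) (b := m + 1)
      (C := ‖s - 1‖ * (2 * ‖s‖ ^ (1 / 30 : ℝ) * m ^ (-s.re - 1 / 30)))
      (fun x hx => (((hasDerivAt_id x).ofReal_comp.const_mul _).add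
        (hasDerivAt_ofReal_cpow' (1 - s) (hm0.trans_le hx.1))).hasDerivWithinAt)
      (fun x hx => by
        have : (s - 1) * (m : ℂ) ^ (-s) * 1 + (1 - s) * (x : ℂ) ^ (1 - s - 1)
            = (s - 1) * ((m : ℂ) ^ (-s) - (x : ℂ) ^ (-s)) := by
          rw [show 1 - s - 1 = -s by ring]; ring
        rw [this, norm_mul]
        gcongr
        exact norm_cpow_sub_cpow_le hm1 ⟨hx.1, hx.2.le⟩ hs) (m + 1) ⟨by linarith, le_rfl⟩
  have e : zetaTerm n s = ((s - 1) * (m : ℂ) ^ (-s) * ((m + 1 : ℝ) : ℂ) +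
      ((m + 1 : ℝ) : ℂ) ^ (1 - s)) - ((s - 1) * (m : ℂ) ^ (-s) * (m : ℂ) + (m : ℂ) ^ (1 - s)) := by
    have : ((n + 2 : ℝ) : ℂ) = ((m + 1 : ℝ) : ℂ) := by rw [hm]; push_cast; ring
    rw [zetaTerm, this, ← hm]
    push_cast
    ring
  rw [e]
  refine h.trans (le_of_eq ?_)
  ring

lemma summable_zetaTerm_majorant : Summable fun n : ℕ => (n + 1 : ℝ) ^ (-(61 / 60) : ℝ) := by
  have h := (Real.summable_nat_rpow (p := -(61 / 60))).2 (by norm_num)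
  simpa using (summable_nat_add_iff 1).2 h

lemma norm_zetaTerm_le' (n : ℕ) {s : ℂ} (hs : 59 / 60 < s.re) :
    ‖zetaTerm n s‖ ≤
      ‖s - 1‖ * (2 * ‖s‖ ^ (1 / 30 : ℝ)) * (n + 1 : ℝ) ^ (-(61 / 60) : ℝ) := by
  refine (norm_zetaTerm_le n (by linarith)).trans ?_
  gcongr
  · simp
  · linarith

lemma isOpen_re_gt : IsOpen {s : ℂ | 59 / 60 < s.re} :=
  isOpen_lt continuous_const Complex.continuous_re

lemma differentiableOn_zetaReg : DifferentiableOn ℂ zetaReg {s | 59 / 60 < s.re} := by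
  intro s hs
  apply DifferentiableAt.differentiableWithinAt
  set U : Set ℂ := {s | 59 / 60 < s.re} ∩ Metric.ball 0 (‖s‖ + 1)
  have hU : IsOpen U := isOpen_re_gt.inter Metric.isOpen_ball
  have hsU : s ∈ U := ⟨hs, by simp⟩
  have key : DifferentiableOn ℂ (fun w => ∑' n : ℕ, zetaTerm n w) U := by
    refine Complex.differentiableOn_tsum_of_summable_norm
      (u := fun n => ((‖s‖ + 2) * (2 * (‖s‖ + 1) ^ (1 / 30 : ℝ))) *
        (n + 1 : ℝ) ^ (-(61 / 60) : ℝ))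
      (summable_zetaTerm_majorant.mul_left _) (fun n => ?_) hU (fun n w hw => ?_)
    · have h1 : ((n + 1 : ℝ) : ℂ) ≠ 0 := by
        rw [Complex.ofReal_ne_zero]; positivity
      have h2 : ((n + 2 : ℝ) : ℂ) ≠ 0 := by
        rw [Complex.ofReal_ne_zero]; positivity
      unfold zetaTerm
      intro w _
      apply DifferentiableAt.differentiableWithinAt
      refine DifferentiableAt.sub (DifferentiableAt.add (DifferentiableAt.mul (by fun_prop) ?_) ?_)
        ?_
      · exact DifferentiableAt.const_cpow (by fun_prop) (Or.inl h1)
      · exact DifferentiableAt.const_cpow (by fun_prop) (Or.inl h2)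
      · exact DifferentiableAt.const_cpow (by fun_prop) (Or.inl h1)
    · refine (norm_zetaTerm_le' n hw.1).trans ?_
      have hw2 : ‖w‖ ≤ ‖s‖ + 1 := by simpa using (Metric.mem_ball.1 hw.2).le
      have : ‖w - 1‖ ≤ ‖s‖ + 2 := by
        refine (norm_sub_le _ _).trans ?_
        simp; linarith
      gcongr
  exact ((key s hsU).differentiableAt (hU.mem_nhds hsU)).const_add 1

lemma exists_norm_zetaReg_le : ∃ C : ℝ, 0 < C ∧ ∀ s : ℂ, 59 / 60 < s.re →
    ‖zetaReg s‖ ≤ C * ((1 + ‖s‖) * (1 + ‖s‖) ^ (1 / 30 : ℝ)) := by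
  set S := ∑' n : ℕ, (n + 1 : ℝ) ^ (-(61 / 60) : ℝ)
  have hS : 0 ≤ S := tsum_nonneg fun n => by positivity
  refine ⟨1 + 2 * S, by positivity, fun s hs => ?_⟩
  have h1 : ‖∑' n : ℕ, zetaTerm n s‖ ≤ ‖s - 1‖ * (2 * ‖s‖ ^ (1 / 30 : ℝ)) * S := by
    rw [← tsum_mul_left]
    exact tsum_of_norm_bounded (summable_zetaTerm_majorant.mul_left _).hasSum
      fun n => norm_zetaTerm_le' n hs
  have h2 : ‖s - 1‖ ≤ 1 + ‖s‖ := by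
    refine (norm_sub_le _ _).trans ?_
    simp [add_comm]
  have h3 : ‖s‖ ^ (1 / 30 : ℝ) ≤ (1 + ‖s‖) ^ (1 / 30 : ℝ) := by
    gcongr; linarith
  have h4 : 1 ≤ (1 + ‖s‖) * (1 + ‖s‖) ^ (1 / 30 : ℝ) := by
    have a : 1 ≤ 1 + ‖s‖ := by simp
    exact one_le_mul_of_one_le_of_one_le a (Real.one_le_rpow a (by norm_num))
  calc ‖zetaReg s‖ ≤ 1 + ‖s - 1‖ * (2 * ‖s‖ ^ (1 / 30 : ℝ)) * S := by
        refine (norm_add_le _ _).trans ?_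
        simpa using h1
    _ ≤ (1 + ‖s‖) * (1 + ‖s‖) ^ (1 / 30 : ℝ) +
        (1 + ‖s‖) * (2 * (1 + ‖s‖) ^ (1 / 30 : ℝ)) * S := by gcongr
    _ = _ := by ring

lemma zetaReg_one : zetaReg 1 = 1 := by
  simp [zetaReg, zetaTerm]

lemma zetaReg_eq {s : ℂ} (hs : 1 < s.re) : zetaReg s = (s - 1) * riemannZeta s := by
  have h1 : HasSum (fun n : ℕ => ((n + 2 : ℝ) : ℂ) ^ (1 - s) - ((n + 1 : ℝ) : ℂ) ^ (1 - s))
      (0 - 1) := by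
    have hsum : Summable fun n : ℕ =>
        ((n + 2 : ℝ) : ℂ) ^ (1 - s) - ((n + 1 : ℝ) : ℂ) ^ (1 - s) := by
      have a : Summable fun n : ℕ => zetaTerm n s :=
        Summable.of_norm_bounded (summable_zetaTerm_majorant.mul_left _)
          fun n => norm_zetaTerm_le' n (by linarith)
      have b : Summable fun n : ℕ => (s - 1) * ((n + 1 : ℝ) : ℂ) ^ (-s) := by
        refine Summable.mul_left _ ?_
        have := (summable_nat_add_iff 1).2 (Complex.summable_one_div_nat_cpow.2 hs)
        refine this.congr fun n => ?_
        rw [Complex.cpow_neg, one_div]; push_cast; rfl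
      refine (a.sub b).congr fun n => ?_
      simp only [zetaTerm]; ring
    refine (hsum.hasSum_iff_tendsto_nat).2 ?_
    have e : ∀ N : ℕ, ∑ n ∈ range N,
        (((n + 2 : ℝ) : ℂ) ^ (1 - s) - ((n + 1 : ℝ) : ℂ) ^ (1 - s))
        = ((N + 1 : ℝ) : ℂ) ^ (1 - s) - 1 := by
      intro N
      have := Finset.sum_range_sub (fun n : ℕ => ((n + 1 : ℝ) : ℂ) ^ (1 - s)) N
      simp only [Nat.cast_add, Nat.cast_one, Nat.cast_zero, zero_add, Complex.ofReal_one,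
        Complex.one_cpow] at this
      rw [← this]
      refine Finset.sum_congr rfl fun n _ => ?_
      rw [add_assoc (n : ℝ), one_add_one_eq_two]
    simp_rw [e]
    refine Tendsto.sub_const ?_ 1
    rw [tendsto_zero_iff_norm_tendsto_zero]
    have e2 : ∀ N : ℕ, ‖((N + 1 : ℝ) : ℂ) ^ (1 - s)‖ = (N + 1 : ℝ) ^ (-(s.re - 1)) := by
      intro N
      rw [Complex.norm_cpow_eq_rpow_re_of_pos (by positivity)]
      simp
    simp_rw [e2]
    exact (tendsto_rpow_neg_atTop (by linarith)).comp
      (tendsto_atTop_add_const_right _ 1 tendsto_natCast_atTop_atTop)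
  have h2 : HasSum (fun n : ℕ => (s - 1) * ((n + 1 : ℝ) : ℂ) ^ (-s))
      ((s - 1) * riemannZeta s) := by
    refine HasSum.mul_left _ ?_
    rw [zeta_eq_tsum_one_div_nat_add_one_cpow hs]
    have := ((summable_nat_add_iff 1).2 (Complex.summable_one_div_nat_cpow.2 hs)).hasSum
    simp only [Nat.cast_add, Nat.cast_one] at this
    refine this.congr_fun fun n => ?_
    rw [Complex.cpow_neg, one_div]; push_cast; rfl
  have h3 : HasSum (fun n : ℕ => zetaTerm n s) ((s - 1) * riemannZeta s + (0 - 1)) := by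
    convert h2.add h1 using 2 with n
    simp only [zetaTerm]; ring
  rw [zetaReg, h3.tsum_eq]; ring

lemma zetaReg_eq_of_one_le {s : ℂ} (hs : 1 ≤ s.re) (h1 : s ≠ 1) :
    zetaReg s = (s - 1) * riemannZeta s := by
  have h := Set.EqOn.of_subset_closure (s := {s : ℂ | 1 < s.re}) (t := {s : ℂ | 1 ≤ s.re} \ {1})
    (f := zetaReg) (g := fun s => (s - 1) * riemannZeta s) (fun s hs => zetaReg_eq hs)
    (differentiableOn_zetaReg.continuousOn.mono fun s hs => by
      have : 1 ≤ s.re := hs.1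
      change 59 / 60 < s.re
      linarith)
    (fun s hs => by
      have := (differentiableAt_riemannZeta hs.2).continuousAt
      exact ((continuousAt_id.sub continuousAt_const).mul this).continuousWithinAt)
    (fun s hs => ⟨le_of_lt (show 1 < s.re from hs), by rintro rfl; simp at hs⟩)
    (by rw [Complex.closure_setOfPred_lt_re]; exact Set.sdiff_subset)
  exact h ⟨hs, h1⟩

lemma zetaReg_ne_zero {s : ℂ} (hs : 1 ≤ s.re) : zetaReg s ≠ 0 := by
  rcases eq_or_ne s 1 with rfl | h1
  · simp [zetaReg_one]
  · rw [zetaReg_eq_of_one_le hs h1]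
    exact mul_ne_zero (sub_ne_zero.2 h1) (riemannZeta_ne_zero_of_one_le_re hs)

/-- The weight `(1 + |t|) ^ (1 / 30)` measuring growth in vertical strips. -/
noncomputable def vertWeight (t : ℝ) : ℝ := (1 + |t|) ^ (1 / 30 : ℝ)

lemma one_le_vertWeight (t : ℝ) : 1 ≤ vertWeight t :=
  Real.one_le_rpow (by simp) (by norm_num)

lemma vertWeight_le_mul {u v c : ℝ} (hc : 1 ≤ c) (h : 1 + |u| ≤ c * (1 + |v|)) :
    vertWeight u ≤ c * vertWeight v := by
  unfold vertWeight
  calc (1 + |u|) ^ (1 / 30 : ℝ) ≤ (c * (1 + |v|)) ^ (1 / 30 : ℝ) := by gcongr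
    _ = c ^ (1 / 30 : ℝ) * (1 + |v|) ^ (1 / 30 : ℝ) :=
      Real.mul_rpow (by positivity) (by positivity)
    _ ≤ c * (1 + |v|) ^ (1 / 30 : ℝ) := by
      gcongr
      exact Real.rpow_le_self_of_one_le hc (by norm_num)

lemma exists_norm_zetaReg_le_strip : ∃ K : ℝ, 0 < K ∧ ∀ s : ℂ, 59 / 60 < s.re → s.re ≤ 4 →
    ‖zetaReg s‖ ≤ K * ((1 + |s.im|) * vertWeight s.im) := by
  obtain ⟨C, hC, h⟩ := exists_norm_zetaReg_le
  refine ⟨25 * C, by positivity, fun s h1 h2 => (h s h1).trans ?_⟩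
  have e : 1 + ‖s‖ ≤ 5 * (1 + |s.im|) := by
    have := Complex.norm_le_abs_re_add_abs_im s
    rw [abs_of_pos (by linarith)] at this
    linarith [abs_nonneg s.im]
  have e2 : (1 + ‖s‖) ^ (1 / 30 : ℝ) ≤ 5 * vertWeight s.im := by
    have := vertWeight_le_mul (u := ‖s‖) (v := s.im) (c := 5) (by norm_num) (by simpa using e)
    simpa [vertWeight] using this
  calc C * ((1 + ‖s‖) * (1 + ‖s‖) ^ (1 / 30 : ℝ))
      ≤ C * ((5 * (1 + |s.im|)) * (5 * vertWeight s.im)) := by gcongr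
    _ = _ := by ring

lemma exists_norm_iteratedDeriv_le {f : ℂ → ℂ} (hf : DifferentiableOn ℂ f {s | 59 / 60 < s.re})
    {V : ℝ → ℝ} (hV : ∀ u v, |u - v| ≤ 1 → V u ≤ 4 * V v)
    {K : ℝ} (hK : 0 < K) (h : ∀ s : ℂ, 59 / 60 < s.re → s.re ≤ 4 → ‖f s‖ ≤ K * V s.im) (k : ℕ) :
    ∃ K' : ℝ, 0 < K' ∧ ∀ s : ℂ, 1 ≤ s.re → s.re ≤ 3 → ‖iteratedDeriv k f s‖ ≤ K' * V s.im := by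
  refine ⟨k.factorial * (K * 4) / (1 / 120) ^ k, by positivity, fun s h1 h2 => ?_⟩
  have hsub : Metric.closedBall s (1 / 120) ⊆ {s | 59 / 60 < s.re} := by
    intro z hz
    have := (Complex.abs_re_le_norm (z - s)).trans (by simpa [dist_eq_norm] using hz)
    rw [Complex.sub_re, abs_le] at this
    change 59 / 60 < z.re
    linarith [this.1]
  refine (Complex.norm_iteratedDeriv_le_of_forall_mem_sphere_norm_le k
    (R := 1 / 120) (C := K * (4 * V s.im)) (by norm_num) ?_ ?_).trans (le_of_eq (by ring))
  · refine DifferentiableOn.diffContOnCl ?_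
    rw [closure_ball _ (by norm_num)]
    exact hf.mono hsub
  · intro z hz
    have hz' := hsub (Metric.sphere_subset_closedBall hz)
    have hn : ‖z - s‖ = 1 / 120 := by simpa [dist_eq_norm] using hz
    have hre := (Complex.abs_re_le_norm (z - s)).trans hn.le
    have him := (Complex.abs_im_le_norm (z - s)).trans hn.le
    rw [Complex.sub_re, abs_le] at hre
    rw [Complex.sub_im] at him
    refine (h z hz' (by linarith [hre.2])).trans ?_
    gcongr
    exact hV _ _ (him.trans (by norm_num))

lemma one_add_abs_le_of_abs_sub_le {u v : ℝ} (h : |u - v| ≤ 1) : 1 + |u| ≤ 2 * (1 + |v|) := by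
  have := abs_sub_abs_le_abs_sub u v
  linarith [abs_nonneg v]

lemma exists_norm_iteratedDeriv_zetaReg_le (k : ℕ) : ∃ K : ℝ, 0 < K ∧
    ∀ s : ℂ, 1 ≤ s.re → s.re ≤ 3 →
      ‖iteratedDeriv k zetaReg s‖ ≤ K * ((1 + |s.im|) * vertWeight s.im) := by
  obtain ⟨K, hK, h⟩ := exists_norm_zetaReg_le_strip
  refine exists_norm_iteratedDeriv_le differentiableOn_zetaReg
    (V := fun t => (1 + |t|) * vertWeight t) (fun u v huv => ?_) hK h k
  have h1 := one_add_abs_le_of_abs_sub_le huv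
  have h2 := vertWeight_le_mul (by norm_num) h1
  have := zero_le_one.trans (one_le_vertWeight u)
  calc (1 + |u|) * vertWeight u ≤ (2 * (1 + |v|)) * (2 * vertWeight v) := by gcongr
    _ = _ := by ring

lemma differentiableOn_dslope_zetaReg :
    DifferentiableOn ℂ (dslope zetaReg 1) {s | 59 / 60 < s.re} :=
  (Complex.differentiableOn_dslope (isOpen_re_gt.mem_nhds (by norm_num))).2
    differentiableOn_zetaReg

lemma dslope_zetaReg_eq {s : ℂ} (hs : s ≠ 1) :
    dslope zetaReg 1 s = (zetaReg s - 1) / (s - 1) := by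
  rw [dslope_of_ne _ hs, slope_def_field, zetaReg_one]

lemma exists_norm_dslope_zetaReg_le : ∃ K : ℝ, 0 < K ∧ ∀ s : ℂ, 59 / 60 < s.re → s.re ≤ 4 →
    ‖dslope zetaReg 1 s‖ ≤ K * vertWeight s.im := by
  obtain ⟨K, hK, h⟩ := exists_norm_zetaReg_le_strip
  obtain ⟨M, hM⟩ := (isCompact_closedBall (1 : ℂ) (1 / 120)).exists_bound_of_continuousOn
    (differentiableOn_dslope_zetaReg.continuousOn.mono (fun z hz => by
      have := (Complex.abs_re_le_norm (z - 1)).trans (by simpa [dist_eq_norm] using hz)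
      rw [Complex.sub_re, abs_le, Complex.one_re] at this
      change 59 / 60 < z.re
      linarith [this.1]))
  refine ⟨|M| + 121 * (K + 1), by positivity, fun s h1 h2 => ?_⟩
  have hw := one_le_vertWeight s.im
  by_cases hs : s ∈ Metric.closedBall (1 : ℂ) (1 / 120)
  · calc ‖dslope zetaReg 1 s‖ ≤ M := hM s hs
      _ ≤ |M| := le_abs_self M
      _ ≤ |M| + 121 * (K + 1) := by linarith
      _ ≤ _ := le_mul_of_one_le_right (by positivity) hw
  · have hd : 1 / 120 < ‖s - 1‖ := by simpa [dist_eq_norm] using hs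
    have hd0 : 0 < ‖s - 1‖ := by linarith
    have him : |s.im| ≤ ‖s - 1‖ := by simpa using Complex.abs_im_le_norm (s - 1)
    rw [dslope_zetaReg_eq (sub_ne_zero.1 (norm_pos_iff.1 hd0)), norm_div, div_le_iff₀ hd0]
    have h5 : 1 + |s.im| ≤ 121 * ‖s - 1‖ := by linarith
    calc ‖zetaReg s - 1‖ ≤ ‖zetaReg s‖ + 1 := by simpa using norm_sub_le (zetaReg s) 1
      _ ≤ K * ((1 + |s.im|) * vertWeight s.im) + (1 + |s.im|) * vertWeight s.im := by
        gcongr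
        · exact h s h1 h2
        · exact one_le_mul_of_one_le_of_one_le (by simp) hw
      _ = (K + 1) * ((1 + |s.im|) * vertWeight s.im) := by ring
      _ ≤ (K + 1) * ((121 * ‖s - 1‖) * vertWeight s.im) := by gcongr
      _ = 0 + 121 * (K + 1) * vertWeight s.im * ‖s - 1‖ := by ring
      _ ≤ |M| * vertWeight s.im * ‖s - 1‖ + 121 * (K + 1) * vertWeight s.im * ‖s - 1‖ := by
        gcongr; positivity
      _ = _ := by ring

lemma exists_norm_iteratedDeriv_dslope_le (k : ℕ) : ∃ K : ℝ, 0 < K ∧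
    ∀ s : ℂ, 1 ≤ s.re → s.re ≤ 3 →
      ‖iteratedDeriv k (dslope zetaReg 1) s‖ ≤ K * vertWeight s.im := by
  obtain ⟨K, hK, h⟩ := exists_norm_dslope_zetaReg_le
  refine exists_norm_iteratedDeriv_le differentiableOn_dslope_zetaReg
    (V := vertWeight) (fun u v huv => ?_) hK h k
  have h2 := vertWeight_le_mul (by norm_num) (one_add_abs_le_of_abs_sub_le huv)
  linarith [one_le_vertWeight v]

lemma one_le_norm_riemannZeta_product {δ : ℝ} (hδ : 0 < δ) (t : ℝ) :
    1 ≤ ‖riemannZeta (1 + δ)‖ ^ 3 * ‖riemannZeta (1 + δ + Complex.I * t)‖ ^ 4 *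
      ‖riemannZeta (1 + δ + 2 * Complex.I * t)‖ := by
  have h := DirichletCharacter.norm_LFunction_product_ge_one (1 : DirichletCharacter ℂ 1) hδ t
  simpa [DirichletCharacter.LFunction_modOne_eq, DirichletCharacter.LFunctionTrivChar] using h

/-- The lower bound for `(s - 1) ζ(s)` given by the inequality `3 + 4 cos θ + cos (2 θ) ≥ 0`. -/
lemma exists_le_norm_zetaReg_pow : ∃ c : ℝ, 0 < c ∧ ∀ δ t : ℝ, 0 < δ → δ ≤ 1 → 1 ≤ |t| →
    c * ((1 + |t|) ^ 4 * δ ^ 3) ≤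
      ‖zetaReg (1 + δ + Complex.I * t)‖ ^ 4 * vertWeight t := by
  obtain ⟨K, hK, h⟩ := exists_norm_zetaReg_le_strip
  refine ⟨1 / (K ^ 3 * (K * 4) * 16), by positivity, fun δ t hδ hδ1 ht => ?_⟩
  have hw := one_le_vertWeight t
  have h341 := one_le_norm_riemannZeta_product hδ t
  set s₁ : ℂ := 1 + δ with hs1
  set s₂ : ℂ := 1 + δ + Complex.I * t with hs2
  set s₃ : ℂ := 1 + δ + 2 * Complex.I * t with hs3
  have r1 : s₁.re = 1 + δ := by simp [hs1]
  have r2 : s₂.re = 1 + δ := by simp [hs2]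
  have r3 : s₃.re = 1 + δ := by simp [hs3]
  have i1 : s₁.im = 0 := by simp [hs1]
  have i2 : s₂.im = t := by simp [hs2]
  have i3 : s₃.im = 2 * t := by simp [hs3]
  have n1 : ‖s₁ - 1‖ = δ := by
    simp [hs1, abs_of_pos hδ]
  have n2 : |t| ≤ ‖s₂ - 1‖ := by simpa [i2] using Complex.abs_im_le_norm (s₂ - 1)
  have n3 : 2 * |t| ≤ ‖s₃ - 1‖ := by
    simpa [i3, abs_mul] using Complex.abs_im_le_norm (s₃ - 1)
  have z1 : ‖zetaReg s₁‖ = δ * ‖riemannZeta s₁‖ := by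
    rw [zetaReg_eq (by linarith), norm_mul, n1]
  have z2 : ‖zetaReg s₂‖ = ‖s₂ - 1‖ * ‖riemannZeta s₂‖ := by
    rw [zetaReg_eq (by linarith), norm_mul]
  have z3 : ‖zetaReg s₃‖ = ‖s₃ - 1‖ * ‖riemannZeta s₃‖ := by
    rw [zetaReg_eq (by linarith), norm_mul]
  have b1 : δ * ‖riemannZeta s₁‖ ≤ K := by
    rw [← z1]
    simpa [i1, vertWeight] using h s₁ (by linarith) (by linarith)
  have b3 : ‖riemannZeta s₃‖ ≤ K * 4 * vertWeight t := by
    have a := h s₃ (by linarith) (by linarith)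
    rw [z3, i3] at a
    have hw2 : vertWeight (2 * t) ≤ 2 * vertWeight t := by
      apply vertWeight_le_mul (by norm_num)
      rw [abs_mul, abs_two]; linarith
    have hp : (0 : ℝ) < 2 * |t| := by linarith
    refine le_of_mul_le_mul_left ?_ hp
    calc 2 * |t| * ‖riemannZeta s₃‖ ≤ ‖s₃ - 1‖ * ‖riemannZeta s₃‖ := by gcongr
      _ ≤ K * ((1 + |2 * t|) * vertWeight (2 * t)) := a
      _ ≤ K * ((4 * |t|) * (2 * vertWeight t)) := by
        gcongr
        · exact zero_le_one.trans (one_le_vertWeight _)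
        · rw [abs_mul, abs_two]; linarith
      _ = _ := by ring
  have b2 : |t| * ‖riemannZeta s₂‖ ≤ ‖zetaReg s₂‖ := by
    rw [z2]; gcongr
  have key : |t| ^ 4 * δ ^ 3 ≤ K ^ 3 * (K * 4) * (‖zetaReg s₂‖ ^ 4 * vertWeight t) := by
    calc |t| ^ 4 * δ ^ 3 = |t| ^ 4 * δ ^ 3 * 1 := by ring
      _ ≤ |t| ^ 4 * δ ^ 3 * (‖riemannZeta s₁‖ ^ 3 * ‖riemannZeta s₂‖ ^ 4 *
          ‖riemannZeta s₃‖) := by gcongr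
      _ = (δ * ‖riemannZeta s₁‖) ^ 3 * (|t| * ‖riemannZeta s₂‖) ^ 4 * ‖riemannZeta s₃‖ := by ring
      _ ≤ K ^ 3 * ‖zetaReg s₂‖ ^ 4 * (K * 4 * vertWeight t) := by gcongr
      _ = _ := by ring
  have ht4 : (1 + |t|) ^ 4 ≤ 16 * |t| ^ 4 := by
    calc (1 + |t|) ^ 4 ≤ (2 * |t|) ^ 4 := by gcongr; linarith
      _ = _ := by ring
  rw [div_mul_eq_mul_div, one_mul, div_le_iff₀ (by positivity)]
  calc (1 + |t|) ^ 4 * δ ^ 3 ≤ 16 * |t| ^ 4 * δ ^ 3 := by gcongr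
    _ = 16 * (|t| ^ 4 * δ ^ 3) := by ring
    _ ≤ 16 * (K ^ 3 * (K * 4) * (‖zetaReg s₂‖ ^ 4 * vertWeight t)) := by gcongr
    _ = _ := by ring

lemma exists_le_norm_zetaReg : ∃ c : ℝ, 0 < c ∧ ∀ s : ℂ, 1 < s.re → s.re ≤ 2 →
    c * (1 + |s.im|) ≤ ‖zetaReg s‖ * vertWeight s.im ^ 4 := by
  obtain ⟨c, hc, hlow⟩ := exists_le_norm_zetaReg_pow
  obtain ⟨K, hK, hder⟩ := exists_norm_iteratedDeriv_zetaReg_le 1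
  simp only [iteratedDeriv_one] at hder
  obtain ⟨m, hm, hmin⟩ : ∃ m : ℝ, 0 < m ∧ ∀ s ∈ Set.Icc (1 : ℝ) 2 ×ℂ Set.Icc (-1 : ℝ) 1,
      m ≤ ‖zetaReg s‖ := by
    have hcpt : IsCompact (Set.Icc (1 : ℝ) 2 ×ℂ Set.Icc (-1 : ℝ) 1) :=
      isCompact_Icc.reProdIm isCompact_Icc
    have hne : (Set.Icc (1 : ℝ) 2 ×ℂ Set.Icc (-1 : ℝ) 1).Nonempty :=
      ⟨1, by simp [Complex.mem_reProdIm]⟩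
    obtain ⟨z, hz, hz'⟩ := hcpt.exists_isMinOn hne
      (differentiableOn_zetaReg.continuousOn.mono fun s hs => by
        have := (Complex.mem_reProdIm.1 hs).1.1
        change 59 / 60 < s.re
        linarith).norm
    exact ⟨‖zetaReg z‖, norm_pos_iff.2 (zetaReg_ne_zero (Complex.mem_reProdIm.1 hz).1.1),
      fun s hs => hz' hs⟩
  set κ := min 1 (c / (16 * K ^ 4)) with hκ
  have hκ0 : 0 < κ := by positivity
  have hκ1 : κ ≤ 1 := min_le_left _ _
  have hκ2 : 16 * K ^ 4 * κ ≤ c := by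
    have := min_le_right 1 (c / (16 * K ^ 4))
    rw [le_div_iff₀ (by positivity)] at this
    linarith
  refine ⟨min (m / 2) (K * κ), by positivity, fun s h1 h2 => ?_⟩
  have hw := one_le_vertWeight s.im
  set W := vertWeight s.im with hW
  have hW0 : 0 < W := by linarith
  rcases le_total 1 |s.im| with ht | ht
  · set T := 1 + |s.im| with hT
    have hT0 : 0 < T := by positivity
    set δ₀ := κ / W ^ 5 with hδ
    have hδ0 : 0 < δ₀ := by positivity
    have hδ1 : δ₀ ≤ 1 := by
      rw [hδ, div_le_one (by positivity)]
      exact hκ1.trans (one_le_pow₀ hw)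
    have big : ∀ δ : ℝ, δ₀ ≤ δ → δ ≤ 1 →
        2 * K * κ * T ≤ ‖zetaReg (1 + δ + Complex.I * s.im)‖ * W ^ 4 := by
      intro δ hd hd1
      have hd0 : 0 < δ := hδ0.trans_le hd
      have hl := hlow δ s.im hd0 hd1 ht
      refine le_of_pow_le_pow_left₀ (n := 4) (by norm_num) (by positivity) ?_
      calc (2 * K * κ * T) ^ 4 = (16 * K ^ 4 * κ) * κ ^ 3 * T ^ 4 := by ring
        _ ≤ c * κ ^ 3 * T ^ 4 := by gcongr
        _ = c * (T ^ 4 * δ₀ ^ 3) * W ^ 15 := by rw [hδ]; field_simp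
        _ ≤ c * (T ^ 4 * δ ^ 3) * W ^ 15 := by gcongr
        _ ≤ ‖zetaReg (1 + δ + Complex.I * s.im)‖ ^ 4 * W * W ^ 15 := by gcongr
        _ = _ := by ring
    have hs : s = 1 + ((s.re - 1 : ℝ) : ℂ) + Complex.I * s.im := by
      apply Complex.ext <;> simp
    have hmain : K * κ * T ≤ ‖zetaReg s‖ * W ^ 4 := by
      rcases le_total δ₀ (s.re - 1) with hd | hd
      · have := big (s.re - 1) hd (by linarith)
        rw [← hs] at this
        have h0 : 0 < K * κ * T := by positivity
        linarith
      · have h3 := big δ₀ le_rfl hδ1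
        set s₀ : ℂ := 1 + δ₀ + Complex.I * s.im with hs0
        have r0 : s₀.re = 1 + δ₀ := by simp [hs0]
        have i0 : s₀.im = s.im := by simp [hs0]
        have hmv := Convex.norm_image_sub_le_of_norm_deriv_le (𝕜 := ℂ) (f := zetaReg)
          (s := Set.Icc (1 : ℝ) 3 ×ℂ {s.im}) (x := s) (y := s₀) (C := K * (T * W))
          (fun z hz => differentiableOn_zetaReg.differentiableAt (isOpen_re_gt.mem_nhds (by
            have := (Complex.mem_reProdIm.1 hz).1.1
            change 59 / 60 < z.re
            linarith)))
          (fun z hz => by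
            obtain ⟨⟨a, b⟩, d⟩ := Complex.mem_reProdIm.1 hz
            have := hder z a b
            rwa [Set.mem_singleton_iff.1 d] at this)
          (((convex_Icc (1 : ℝ) 3).linear_preimage Complex.reLm).inter
            ((convex_singleton s.im).linear_preimage Complex.imLm))
          (Complex.mem_reProdIm.2 ⟨⟨h1.le, by linarith⟩, rfl⟩)
          (Complex.mem_reProdIm.2 ⟨⟨by linarith, by linarith⟩, i0⟩)
        have hdist : ‖s₀ - s‖ ≤ δ₀ := by
          have : s₀ - s = ((1 + δ₀ - s.re : ℝ) : ℂ) := by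
            apply Complex.ext <;> simp [r0, i0]
          rw [this, Complex.norm_real, Real.norm_eq_abs, abs_of_nonneg (by linarith)]
          linarith
        have h4 : ‖zetaReg s₀‖ ≤ ‖zetaReg s‖ + K * (T * W) * δ₀ := by
          have a := norm_sub_norm_le (zetaReg s₀) (zetaReg s)
          have b : K * (T * W) * ‖s₀ - s‖ ≤ K * (T * W) * δ₀ := by gcongr
          linarith
        have h5 : K * (T * W) * δ₀ * W ^ 4 = K * κ * T := by rw [hδ]; field_simp
        have h6 := mul_le_mul_of_nonneg_right h4 (by positivity : 0 ≤ W ^ 4)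
        rw [add_mul, h5] at h6
        linarith
    refine le_trans ?_ hmain
    gcongr
    exact min_le_right _ _
  · have h3 := hmin s (Complex.mem_reProdIm.2 ⟨⟨h1.le, h2⟩, abs_le.1 ht⟩)
    calc min (m / 2) (K * κ) * (1 + |s.im|) ≤ m / 2 * 2 := by
          gcongr
          · exact min_le_left _ _
          · linarith
      _ = m := by ring
      _ ≤ ‖zetaReg s‖ := h3
      _ ≤ _ := le_mul_of_one_le_right (norm_nonneg _) (one_le_pow₀ hw)

lemma hasDerivAt_iteratedDeriv {f : ℂ → ℂ} {s : ℂ} (hf : AnalyticAt ℂ f s) (k : ℕ) :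
    HasDerivAt (iteratedDeriv k f) (iteratedDeriv (k + 1) f s) s := by
  rw [iteratedDeriv_succ, iteratedDeriv_eq_iterate]
  exact (hf.iterated_deriv k).differentiableAt.hasDerivAt

lemma hasDerivAt_iteratedDeriv_div {f : ℂ → ℂ} {s : ℂ} (hf : AnalyticAt ℂ f s) (h0 : f s ≠ 0)
    (k : ℕ) :
    HasDerivAt (fun z => iteratedDeriv k f z / f z)
      (iteratedDeriv (k + 1) f s / f s -
        iteratedDeriv k f s / f s * (iteratedDeriv 1 f s / f s)) s := by
  have h1 := hasDerivAt_iteratedDeriv hf 0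
  simp only [iteratedDeriv_zero, zero_add] at h1
  refine ((hasDerivAt_iteratedDeriv hf k).div h1 h0).congr_deriv ?_
  field_simp

/-- The coefficients `Λ(n) - 1`, as complex numbers. -/
noncomputable def vonMangoldtSubOne (n : ℕ) : ℂ := (ArithmeticFunction.vonMangoldt n : ℂ) - 1

lemma LSeriesSummable_vonMangoldtSubOne {s : ℂ} (hs : 1 < s.re) :
    LSeriesSummable vonMangoldtSubOne s :=
  (ArithmeticFunction.LSeriesSummable_vonMangoldt hs).sub (LSeriesSummable_one_iff.2 hs)

lemma abscissa_vonMangoldtSubOne : LSeries.abscissaOfAbsConv vonMangoldtSubOne ≤ 1 := by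
  refine LSeries.abscissaOfAbsConv_le_of_forall_lt_LSeriesSummable (x := 1) fun y hy => ?_
  exact LSeriesSummable_vonMangoldtSubOne (by simpa using hy)

lemma LSeries_vonMangoldtSubOne {s : ℂ} (hs : 1 < s.re) :
    LSeries vonMangoldtSubOne s =
      -(iteratedDeriv 1 zetaReg s / zetaReg s) - dslope zetaReg 1 s := by
  have hs1 : s ≠ 1 := by rintro rfl; simp at hs
  have hs1' : s - 1 ≠ 0 := sub_ne_zero.2 hs1
  have hz : riemannZeta s ≠ 0 := riemannZeta_ne_zero_of_one_le_re hs.le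
  have h1 : LSeries vonMangoldtSubOne s = -deriv riemannZeta s / riemannZeta s - riemannZeta s := by
    rw [← ArithmeticFunction.LSeries_vonMangoldt_eq_deriv_riemannZeta_div hs,
      ← LSeries_one_eq_riemannZeta hs]
    exact LSeries_sub (ArithmeticFunction.LSeriesSummable_vonMangoldt hs)
      (LSeriesSummable_one_iff.2 hs)
  have h2 : deriv zetaReg s = riemannZeta s + (s - 1) * deriv riemannZeta s := by
    have e : zetaReg =ᶠ[nhds s] fun z => (z - 1) * riemannZeta z := by
      filter_upwards [(isOpen_lt continuous_const Complex.continuous_re).mem_nhds hs] with z hz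
      exact zetaReg_eq hz
    rw [e.deriv_eq]
    refine (((hasDerivAt_id s).sub_const 1).mul
      (differentiableAt_riemannZeta hs1).hasDerivAt).deriv.trans ?_
    simp
  rw [h1, iteratedDeriv_one, h2, dslope_zetaReg_eq hs1, zetaReg_eq hs]
  field_simp
  ring

lemma LSeries_logMul_logMul_vonMangoldtSubOne {s : ℂ} (hs : 1 < s.re) :
    LSeries (LSeries.logMul (LSeries.logMul vonMangoldtSubOne)) s =
      -(iteratedDeriv 3 zetaReg s / zetaReg s -
        3 * (iteratedDeriv 1 zetaReg s / zetaReg s) * (iteratedDeriv 2 zetaReg s / zetaReg s) +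
        2 * (iteratedDeriv 1 zetaReg s / zetaReg s) ^ 3) -
      iteratedDeriv 2 (dslope zetaReg 1) s := by
  have hopen : IsOpen {z : ℂ | 1 < z.re} := isOpen_lt continuous_const Complex.continuous_re
  have hmem : ∀ z : ℂ, 1 < z.re → {z : ℂ | 59 / 60 < z.re} ∈ nhds z := fun z hz =>
    isOpen_re_gt.mem_nhds (by change 59 / 60 < z.re; linarith)
  have hZ : ∀ z : ℂ, 1 < z.re → AnalyticAt ℂ zetaReg z := fun z hz =>
    differentiableOn_zetaReg.analyticAt (hmem z hz)
  have hH : ∀ z : ℂ, 1 < z.re → AnalyticAt ℂ (dslope zetaReg 1) z := fun z hz =>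
    differentiableOn_dslope_zetaReg.analyticAt (hmem z hz)
  have d1 : ∀ z : ℂ, 1 < z.re → deriv (LSeries vonMangoldtSubOne) z =
      -(iteratedDeriv 2 zetaReg z / zetaReg z - iteratedDeriv 1 zetaReg z / zetaReg z *
        (iteratedDeriv 1 zetaReg z / zetaReg z)) - iteratedDeriv 1 (dslope zetaReg 1) z := by
    intro z hz
    have e : LSeries vonMangoldtSubOne =ᶠ[nhds z] fun w =>
        -(iteratedDeriv 1 zetaReg w / zetaReg w) - dslope zetaReg 1 w := by
      filter_upwards [hopen.mem_nhds hz] with w hw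
      exact LSeries_vonMangoldtSubOne hw
    rw [e.deriv_eq]
    have h := hasDerivAt_iteratedDeriv (hH z hz) 0
    rw [iteratedDeriv_zero] at h
    exact ((hasDerivAt_iteratedDeriv_div (hZ z hz) (zetaReg_ne_zero hz.le) 1).neg.sub h).deriv
  have e : deriv (LSeries vonMangoldtSubOne) =ᶠ[nhds s] fun z =>
      -(iteratedDeriv 2 zetaReg z / zetaReg z - iteratedDeriv 1 zetaReg z / zetaReg z *
        (iteratedDeriv 1 zetaReg z / zetaReg z)) - iteratedDeriv 1 (dslope zetaReg 1) z := by
    filter_upwards [hopen.mem_nhds hs] with w hw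
    exact d1 w hw
  have habs : LSeries.abscissaOfAbsConv vonMangoldtSubOne < s.re :=
    abscissa_vonMangoldtSubOne.trans_lt (by exact_mod_cast hs)
  have h2 := LSeries_iteratedDeriv 2 habs
  rw [show (2 : ℕ) = 1 + 1 from rfl, iteratedDeriv_succ, iteratedDeriv_one, e.deriv_eq] at h2
  have q1 := hasDerivAt_iteratedDeriv_div (hZ s hs) (zetaReg_ne_zero hs.le) 1
  have q2 := hasDerivAt_iteratedDeriv_div (hZ s hs) (zetaReg_ne_zero hs.le) 2
  have h3 := ((q2.sub (q1.mul q1)).neg.sub (hasDerivAt_iteratedDeriv (hH s hs) 1)).deriv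
  have h4 := h3.symm.trans h2
  simp only [Function.iterate_succ, Function.iterate_zero, Function.comp_apply, id] at h4
  norm_num at h4
  rw [← h4, iteratedDeriv_one]
  ring

lemma exists_norm_LSeries_logMul_logMul_le : ∃ C : ℝ, 0 < C ∧ ∀ s : ℂ, 1 < s.re → s.re ≤ 2 →
    ‖LSeries (LSeries.logMul (LSeries.logMul vonMangoldtSubOne)) s‖ ≤
      C * (1 + |s.im|) ^ (1 / 2 : ℝ) := by
  obtain ⟨c, hc, hlow⟩ := exists_le_norm_zetaReg
  have quot : ∀ k : ℕ, ∃ K : ℝ, 0 < K ∧ ∀ s : ℂ, 1 < s.re → s.re ≤ 2 →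
      ‖iteratedDeriv k zetaReg s / zetaReg s‖ ≤ K * vertWeight s.im ^ 5 := by
    intro k
    obtain ⟨K, hK, h⟩ := exists_norm_iteratedDeriv_zetaReg_le k
    refine ⟨K / c, by positivity, fun s h1 h2 => ?_⟩
    have hZ : 0 < ‖zetaReg s‖ := norm_pos_iff.2 (zetaReg_ne_zero h1.le)
    have hW : 0 < vertWeight s.im := zero_lt_one.trans_le (one_le_vertWeight _)
    rw [norm_div, div_le_iff₀ hZ]
    calc ‖iteratedDeriv k zetaReg s‖ ≤ K * ((1 + |s.im|) * vertWeight s.im) :=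
          h s h1.le (by linarith)
      _ = K / c * (c * (1 + |s.im|)) * vertWeight s.im := by field_simp
      _ ≤ K / c * (‖zetaReg s‖ * vertWeight s.im ^ 4) * vertWeight s.im := by
        exact mul_le_mul_of_nonneg_right
          (mul_le_mul_of_nonneg_left (hlow s h1 h2) (by positivity)) hW.le
      _ = _ := by ring
  obtain ⟨K₁, hK1, h1⟩ := quot 1
  obtain ⟨K₂, hK2, h2⟩ := quot 2
  obtain ⟨K₃, hK3, h3⟩ := quot 3
  obtain ⟨K₄, hK4, h4⟩ := exists_norm_iteratedDeriv_dslope_le 2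
  refine ⟨K₃ + 3 * K₁ * K₂ + 2 * K₁ ^ 3 + K₄, by positivity, fun s hs hs2 => ?_⟩
  have hw := one_le_vertWeight s.im
  have e : (1 + |s.im|) ^ (1 / 2 : ℝ) = vertWeight s.im ^ 15 := by
    rw [vertWeight, ← Real.rpow_natCast, ← Real.rpow_mul (by positivity)]; norm_num
  rw [e, LSeries_logMul_logMul_vonMangoldtSubOne hs]
  have a1 := h1 s hs hs2
  have a2 := h2 s hs hs2
  have a3 := h3 s hs hs2
  have a4 := h4 s hs.le (by linarith)
  generalize iteratedDeriv 1 zetaReg s / zetaReg s = q₁ at *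
  generalize iteratedDeriv 2 zetaReg s / zetaReg s = q₂ at *
  generalize iteratedDeriv 3 zetaReg s / zetaReg s = q₃ at *
  generalize iteratedDeriv 2 (dslope zetaReg 1) s = q₄ at *
  generalize vertWeight s.im = W at *
  have hW0 : 0 < W := by linarith
  calc ‖-(q₃ - 3 * q₁ * q₂ + 2 * q₁ ^ 3) - q₄‖
      ≤ ‖q₃‖ + 3 * ‖q₁‖ * ‖q₂‖ + 2 * ‖q₁‖ ^ 3 + ‖q₄‖ := by
        refine (norm_sub_le _ _).trans ?_
        rw [norm_neg]
        gcongr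
        refine (norm_add_le _ _).trans ?_
        refine add_le_add ((norm_sub_le _ _).trans ?_) ?_ <;> simp
    _ ≤ K₃ * W ^ 5 + 3 * (K₁ * W ^ 5) * (K₂ * W ^ 5) + 2 * (K₁ * W ^ 5) ^ 3 + K₄ * W := by gcongr
    _ = K₃ * W ^ 5 + 3 * K₁ * K₂ * W ^ 10 + 2 * K₁ ^ 3 * W ^ 15 + K₄ * W ^ 1 := by ring
    _ ≤ K₃ * W ^ 15 + 3 * K₁ * K₂ * W ^ 15 + 2 * K₁ ^ 3 * W ^ 15 + K₄ * W ^ 15 := by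
      gcongr <;> norm_num
    _ = _ := by ring

lemma norm_inv_sq_le {σ : ℝ} (hσ : 1 ≤ σ) (t : ℝ) :
    ‖-(1 / ((σ : ℂ) + t * Complex.I) ^ 2)‖ ≤ 2 * (1 + ‖t‖) ^ (-2 : ℝ) := by
  have h : (1 + ‖t‖) ^ 2 / 2 ≤ ‖((σ : ℂ) + t * Complex.I) ^ 2‖ := by
    rw [norm_pow, ← Complex.normSq_eq_norm_sq, Complex.normSq_add_mul_I, Real.norm_eq_abs]
    nlinarith [sq_nonneg (1 - |t|), sq_abs t]
  rw [norm_neg, norm_div, norm_one, Real.rpow_neg (by positivity), Real.rpow_two]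
  calc 1 / ‖((σ : ℂ) + t * Complex.I) ^ 2‖ ≤ 1 / ((1 + ‖t‖) ^ 2 / 2) := by gcongr
    _ = _ := by field_simp

lemma ofReal_add_mul_I_ne_zero {σ : ℝ} (hσ : 1 ≤ σ) (t : ℝ) : (σ : ℂ) + t * Complex.I ≠ 0 := by
  intro h
  have := congrArg Complex.re h
  simp at this
  linarith

lemma integrable_inv_sq {σ : ℝ} (hσ : 1 ≤ σ) :
    MeasureTheory.Integrable fun t : ℝ => -(1 / ((σ : ℂ) + t * Complex.I) ^ 2) := by
  have h : MeasureTheory.Integrable fun t : ℝ => 2 * (1 + ‖t‖) ^ (-2 : ℝ) :=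
    (integrable_one_add_norm (by norm_num)).const_mul 2
  refine h.mono' (Continuous.aestronglyMeasurable ?_)
    (Eventually.of_forall fun t => norm_inv_sq_le hσ t)
  have : ∀ t : ℝ, ((σ : ℂ) + t * Complex.I) ^ 2 ≠ 0 := fun t =>
    pow_ne_zero 2 (ofReal_add_mul_I_ne_zero hσ t)
  fun_prop (disch := exact this _)

/-- The function equal to `log` on `(0, 1]` and to `0` elsewhere. -/
noncomputable def logCut : ℝ → ℂ :=
  fun y => Real.log y • Set.indicator (Set.Ioc 0 1) (fun _ => (1 : ℂ)) y

lemma hasMellin_logCut {s : ℂ} (hs : 0 < s.re) : HasMellin logCut s (-(1 / s ^ 2)) := by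
  have hs0 : s ≠ 0 := by rintro rfl; simp at hs
  have h := mellin_hasDerivAt_of_isBigO_rpow (a := s.re + 1) (b := 0) (s := s)
    (f := Set.indicator (Set.Ioc 0 1) (fun _ => (1 : ℂ))) ?_ ?_ (by linarith) ?_ hs
  · refine ⟨h.1, ?_⟩
    have e : mellin (Set.indicator (Set.Ioc 0 1) (fun _ => (1 : ℂ))) =ᶠ[nhds s] fun z => z⁻¹ := by
      filter_upwards [(isOpen_lt continuous_const Complex.continuous_re).mem_nhds hs] with z hz
      rw [(hasMellin_one_Ioc hz).2, one_div]
    have h2 := h.2.unique (e.hasDerivAt_iff.2 (hasDerivAt_inv hs0))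
    rw [one_div]
    exact h2
  · refine MeasureTheory.LocallyIntegrable.locallyIntegrableOn ?_ _
    exact (MeasureTheory.locallyIntegrable_const (1 : ℂ)).indicator measurableSet_Ioc
  · refine Asymptotics.IsBigO.of_bound 1 ?_
    filter_upwards [eventually_gt_atTop 1] with x hx
    rw [Set.indicator_of_notMem (by simp [hx])]
    simp
  · refine Asymptotics.IsBigO.of_bound 1 (Eventually.of_forall fun x => ?_)
    by_cases hx : x ∈ Set.Ioc (0 : ℝ) 1 <;> simp [hx]

lemma continuousAt_logCut {y : ℝ} (hy : 0 < y) : ContinuousAt logCut y := by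
  have h : ContinuousAt (fun y : ℝ => ((min (Real.log y) 0 : ℝ) : ℂ)) y :=
    Complex.continuous_ofReal.continuousAt.comp
      ((Real.continuousAt_log hy.ne').min continuousAt_const)
  refine h.congr ?_
  filter_upwards [lt_mem_nhds hy] with z hz
  rcases le_total z 1 with h1 | h1
  · rw [logCut, Set.indicator_of_mem (show z ∈ Set.Ioc 0 1 from ⟨hz, h1⟩),
      min_eq_left (Real.log_nonpos hz.le h1)]
    simp
  · rcases h1.eq_or_lt with rfl | h1
    · simp [logCut]
    · rw [logCut, Set.indicator_of_notMem (by simp [h1]), min_eq_right (Real.log_nonneg h1.le)]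
      simp

lemma integral_cpow_mul_inv_sq {σ y : ℝ} (hσ : 1 ≤ σ) (hy : 0 < y) :
    ∫ t : ℝ, (y : ℂ) ^ (-((σ : ℂ) + t * Complex.I)) * -(1 / ((σ : ℂ) + t * Complex.I) ^ 2) =
      2 * Real.pi * logCut y := by
  have hre : ∀ t : ℝ, 0 < ((σ : ℂ) + t * Complex.I).re := fun t => by simp; linarith
  have hM : ∀ t : ℝ, mellin logCut ((σ : ℂ) + t * Complex.I) =
      -(1 / ((σ : ℂ) + t * Complex.I) ^ 2) := fun t => (hasMellin_logCut (hre t)).2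
  have h := mellinInv_mellin_eq σ logCut hy
    (hasMellin_logCut (by simpa using zero_lt_one.trans_le hσ)).1
    (by
      unfold Complex.VerticalIntegrable
      simp_rw [hM]
      exact integrable_inv_sq hσ)
    (continuousAt_logCut hy)
  rw [mellinInv] at h
  simp_rw [hM, smul_eq_mul] at h
  rw [← h]
  have : (Real.pi : ℂ) ≠ 0 := by exact_mod_cast Real.pi_ne_zero
  generalize (∫ t : ℝ, _ : ℂ) = I
  rw [Complex.real_smul]
  push_cast
  field_simp

lemma norm_sum_mul_log_le {a : ℕ → ℂ} {σ x C : ℝ} (hσ : 1 ≤ σ) (hx : 0 < x)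
    (ha : LSeriesSummable a σ)
    (hC : ∀ t : ℝ, ‖LSeries a (σ + t * Complex.I)‖ ≤ C * (1 + |t|) ^ (1 / 2 : ℝ)) :
    ‖∑ n ∈ Icc 1 ⌊x⌋₊, a n * Real.log (x / n)‖ ≤
      C * x ^ σ * ∫ t : ℝ, (1 + ‖t‖) ^ (-(3 / 2) : ℝ) := by
  set q : ℝ → ℂ := fun t => (σ : ℂ) + t * Complex.I with hq
  have hqre : ∀ t, (q t).re = σ := fun t => by simp [hq]
  have hqc : Continuous q := by fun_prop
  have hxc : (x : ℂ) ≠ 0 := by exact_mod_cast hx.ne'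
  set F : ℕ → ℝ → ℂ := fun n t => LSeries.term a (q t) n * (x ^ q t * -(1 / q t ^ 2)) with hF
  have hterm : ∀ n : ℕ, ∀ t, ‖LSeries.term a (q t) n‖ = ‖LSeries.term a σ n‖ := fun n t => by
    rw [LSeries.norm_term_eq, LSeries.norm_term_eq, hqre, Complex.ofReal_re]
  have hxn : ∀ t, ‖(x : ℂ) ^ q t‖ = x ^ σ := fun t => by
    rw [Complex.norm_cpow_eq_rpow_re_of_pos hx, hqre]
  have hFn : ∀ n t, ‖F n t‖ = ‖LSeries.term a σ n‖ * (x ^ σ * ‖-(1 / q t ^ 2)‖) := fun n t => by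
    rw [hF, norm_mul, norm_mul, hterm, hxn]
  have hFint : ∀ n, MeasureTheory.Integrable (F n) := by
    intro n
    refine (((integrable_inv_sq hσ).norm.const_mul (x ^ σ)).const_mul
      ‖LSeries.term a σ n‖).mono' ?_ (Eventually.of_forall fun t => (hFn n t).le)
    have hc1 : Continuous fun t => LSeries.term a (q t) n := by
      rcases eq_or_ne n 0 with rfl | hn
      · simpa using continuous_const
      · simp only [LSeries.term_of_ne_zero hn]
        have hn' : (n : ℂ) ≠ 0 := by exact_mod_cast hn
        refine continuous_const.div (hqc.const_cpow (Or.inl hn')) fun t => ?_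
        simp [Complex.cpow_eq_zero_iff, hn']
    have hc2 : Continuous fun t => (x : ℂ) ^ q t := hqc.const_cpow (Or.inl hxc)
    exact (hc1.aestronglyMeasurable).mul
      (hc2.aestronglyMeasurable.mul (integrable_inv_sq hσ).aestronglyMeasurable)
  have hFsum : Summable fun n => ∫ t, ‖F n t‖ := by
    simp_rw [hFn, MeasureTheory.integral_const_mul]
    exact (Summable.norm ha).mul_right _
  have hval : ∀ n, ∫ t, F n t = 2 * Real.pi * (if n = 0 then 0 else a n * logCut (n / x)) := by
    intro n
    rcases eq_or_ne n 0 with rfl | hn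
    · simp [hF]
    · have hn0 : (0 : ℝ) < n := by positivity
      have hn' : (n : ℂ) ≠ 0 := by exact_mod_cast hn
      rw [if_neg hn, mul_left_comm, ← integral_cpow_mul_inv_sq hσ (div_pos hn0 hx),
        ← MeasureTheory.integral_const_mul]
      refine MeasureTheory.integral_congr_ae (Eventually.of_forall fun t => ?_)
      simp only [hF, LSeries.term_of_ne_zero hn]
      rw [Complex.ofReal_div, Complex.div_cpow_ofReal_nonneg hn0.le hx.le, Complex.cpow_neg,
        Complex.cpow_neg, Complex.ofReal_natCast]
      have : (x : ℂ) ^ q t ≠ 0 := by simp [Complex.cpow_eq_zero_iff, hxc]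
      have : (n : ℂ) ^ q t ≠ 0 := by simp [Complex.cpow_eq_zero_iff, hn']
      change _ = a n * (((n : ℂ) ^ q t)⁻¹ / ((x : ℂ) ^ q t)⁻¹ * -(1 / q t ^ 2))
      field_simp
  have hs1 := MeasureTheory.hasSum_integral_of_summable_integral_norm hFint hFsum
  have hs2 : HasSum (fun n => ∫ t, F n t)
      (∑ n ∈ Icc 1 ⌊x⌋₊, ∫ t, F n t) := by
    refine hasSum_sum_of_ne_finset_zero fun n hn => ?_
    rw [hval]
    rcases eq_or_ne n 0 with rfl | hn0
    · simp
    · have : x < n := by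
        rw [mem_Icc, not_and, not_le] at hn
        exact (Nat.floor_lt hx.le).1 (hn (by omega))
      have : 1 < n / x := by rwa [one_lt_div hx]
      rw [logCut, Set.indicator_of_notMem (by simp [this])]
      simp
  have heq := hs2.unique hs1
  have hL : ∑ n ∈ Icc 1 ⌊x⌋₊, ∫ t, F n t =
      -(2 * Real.pi) * ∑ n ∈ Icc 1 ⌊x⌋₊, a n * Real.log (x / n) := by
    rw [mul_sum]
    refine sum_congr rfl fun n hn => ?_
    obtain ⟨h1, h2⟩ := mem_Icc.1 hn
    have hn0 : (0 : ℝ) < n := by exact_mod_cast h1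
    have hnx : (n : ℝ) ≤ x := (Nat.le_floor_iff hx.le).1 h2
    rw [hval, if_neg (by omega), logCut, Set.indicator_of_mem (show (n / x : ℝ) ∈ Set.Ioc 0 1 from
      ⟨by positivity, by rwa [div_le_one hx]⟩), ← inv_div x (n : ℝ), Real.log_inv]
    simp
  have hR : ‖∫ t, ∑' n, F n t‖ ≤ ∫ t : ℝ, C * x ^ σ * 2 * (1 + ‖t‖) ^ (-(3 / 2) : ℝ) := by
    refine MeasureTheory.norm_integral_le_of_norm_le
      ((integrable_one_add_norm (by norm_num)).const_mul _) (Eventually.of_forall fun t => ?_)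
    have : ∑' n, F n t = LSeries a (q t) * (x ^ q t * -(1 / q t ^ 2)) := by
      simp only [hF]
      rw [tsum_mul_right]; rfl
    rw [this, norm_mul, norm_mul, hxn]
    have e : (1 + ‖t‖) ^ (-(3 / 2) : ℝ) = (1 + |t|) ^ (1 / 2 : ℝ) * (1 + ‖t‖) ^ (-2 : ℝ) := by
      rw [Real.norm_eq_abs, ← Real.rpow_add (by positivity)]; norm_num
    calc ‖LSeries a (q t)‖ * (x ^ σ * ‖-(1 / q t ^ 2)‖)
        ≤ C * (1 + |t|) ^ (1 / 2 : ℝ) * (x ^ σ * (2 * (1 + ‖t‖) ^ (-2 : ℝ))) :=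
          mul_le_mul (hC t) (by gcongr; exact norm_inv_sq_le hσ t) (by positivity)
            ((norm_nonneg _).trans (hC t))
      _ = _ := by rw [e]; ring
  rw [← heq, hL, norm_mul, MeasureTheory.integral_const_mul] at hR
  have hpi : ‖-(2 * (Real.pi : ℂ))‖ = 2 * Real.pi := by
    rw [norm_neg, norm_mul, Complex.norm_real, Real.norm_eq_abs, abs_of_pos Real.pi_pos]; simp
  rw [hpi] at hR
  have h0 := norm_nonneg (∑ n ∈ Icc 1 ⌊x⌋₊, a n * (Real.log (x / n) : ℂ))
  nlinarith [Real.pi_gt_three]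

lemma exists_abs_sum_mul_log_le : ∃ C : ℝ, 0 < C ∧ ∀ x : ℝ, Real.exp 1 ≤ x →
    |∑ n ∈ Icc 1 ⌊x⌋₊, (ArithmeticFunction.vonMangoldt n - 1) * Real.log n ^ 2 *
      Real.log (x / n)| ≤ C * x := by
  obtain ⟨C, hC, h⟩ := exists_norm_LSeries_logMul_logMul_le
  set J := ∫ t : ℝ, (1 + ‖t‖) ^ (-(3 / 2) : ℝ)
  have hJ : 0 ≤ J := MeasureTheory.integral_nonneg fun t => by positivity
  refine ⟨C * Real.exp 1 * (J + 1), by positivity, fun x hx => ?_⟩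
  have hx0 : 0 < x := (Real.exp_pos 1).trans_le hx
  have hlog : 1 ≤ Real.log x := by rwa [Real.le_log_iff_exp_le hx0]
  have hinv : 1 / Real.log x ≤ 1 := by rw [div_le_one (by linarith)]; exact hlog
  have hinv0 : 0 < 1 / Real.log x := by positivity
  set σ := 1 + 1 / Real.log x with hσ
  have hxσ : x ^ σ = Real.exp 1 * x := by
    rw [hσ, Real.rpow_add hx0, Real.rpow_one, mul_comm, Real.rpow_def_of_pos hx0]
    field_simp
  have hsum : LSeriesSummable (LSeries.logMul (LSeries.logMul vonMangoldtSubOne)) σ := by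
    refine LSeriesSummable_of_abscissaOfAbsConv_lt_re ?_
    rw [LSeries.abscissaOfAbsConv_logMul, LSeries.abscissaOfAbsConv_logMul]
    refine abscissa_vonMangoldtSubOne.trans_lt ?_
    rw [Complex.ofReal_re]
    exact_mod_cast (by linarith : 1 < σ)
  have key := norm_sum_mul_log_le (C := C) (by linarith : 1 ≤ σ) hx0 hsum fun t => by
    simpa using h (σ + t * Complex.I) (by simp; linarith) (by simp; linarith)
  have e : ∑ n ∈ Icc 1 ⌊x⌋₊, LSeries.logMul (LSeries.logMul vonMangoldtSubOne) n *
        (Real.log (x / n) : ℂ) =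
      ((∑ n ∈ Icc 1 ⌊x⌋₊, (ArithmeticFunction.vonMangoldt n - 1) * Real.log n ^ 2 *
        Real.log (x / n) : ℝ) : ℂ) := by
    push_cast
    refine sum_congr rfl fun n _ => ?_
    simp only [LSeries.logMul, vonMangoldtSubOne]
    ring
  rw [e, Complex.norm_real, Real.norm_eq_abs, hxσ] at key
  refine key.trans ?_
  have : 0 ≤ C * Real.exp 1 * x := by positivity
  linarith

lemma sum_mul_log_sub_bounds {w : ℕ → ℝ} (hw : ∀ n, 0 ≤ w n) {x y : ℝ} (hx : 0 < x) (hxy : x ≤ y) :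
    (∑ n ∈ Ioc 0 ⌊x⌋₊, w n) * Real.log (y / x) ≤
        ∑ n ∈ Ioc 0 ⌊y⌋₊, w n * Real.log (y / n) - ∑ n ∈ Ioc 0 ⌊x⌋₊, w n * Real.log (x / n) ∧
      ∑ n ∈ Ioc 0 ⌊y⌋₊, w n * Real.log (y / n) - ∑ n ∈ Ioc 0 ⌊x⌋₊, w n * Real.log (x / n) ≤
        (∑ n ∈ Ioc 0 ⌊y⌋₊, w n) * Real.log (y / x) := by
  have hy : 0 < y := hx.trans_le hxy
  have hfl : ⌊x⌋₊ ≤ ⌊y⌋₊ := Nat.floor_mono hxy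
  rw [← sum_Ioc_consecutive _ (Nat.zero_le _) hfl, ← sum_Ioc_consecutive w (Nat.zero_le _) hfl,
    add_mul, add_sub_right_comm, ← sum_sub_distrib]
  have e : ∑ n ∈ Ioc 0 ⌊x⌋₊, (w n * Real.log (y / n) - w n * Real.log (x / n)) =
      (∑ n ∈ Ioc 0 ⌊x⌋₊, w n) * Real.log (y / x) := by
    rw [sum_mul]
    refine sum_congr rfl fun n hn => ?_
    have : (n : ℝ) ≠ 0 := by exact_mod_cast (mem_Ioc.1 hn).1.ne'
    rw [Real.log_div hy.ne' this, Real.log_div hx.ne' this, Real.log_div hy.ne' hx.ne']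
    ring
  rw [e]
  constructor
  · refine le_add_of_nonneg_right (sum_nonneg fun n hn => mul_nonneg (hw n) (Real.log_nonneg ?_))
    obtain ⟨h1, h2⟩ := mem_Ioc.1 hn
    have hn0 : (0 : ℝ) < n := by exact_mod_cast (Nat.zero_le _).trans_lt h1
    rw [one_le_div hn0]
    exact (Nat.le_floor_iff hy.le).1 h2
  · gcongr
    rw [sum_mul]
    refine sum_le_sum fun n hn => mul_le_mul_of_nonneg_left ?_ (hw n)
    obtain ⟨h1, h2⟩ := mem_Ioc.1 hn
    have hn0 : (0 : ℝ) < n := by exact_mod_cast (Nat.zero_le _).trans_lt h1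
    have := (Nat.floor_lt hx.le).1 h1
    gcongr

lemma sum_Ioc_log_sq_le {x y : ℝ} (hx : 0 < x) (hxy : x ≤ y) :
    ∑ n ∈ Ioc 0 ⌊y⌋₊, Real.log n ^ 2 - ∑ n ∈ Ioc 0 ⌊x⌋₊, Real.log n ^ 2 ≤
      (y - x + 1) * Real.log y ^ 2 := by
  have hfl : ⌊x⌋₊ ≤ ⌊y⌋₊ := Nat.floor_mono hxy
  rw [← sum_Ioc_consecutive _ (Nat.zero_le _) hfl, add_sub_cancel_left]
  calc ∑ n ∈ Ioc ⌊x⌋₊ ⌊y⌋₊, Real.log n ^ 2 ≤ ∑ n ∈ Ioc ⌊x⌋₊ ⌊y⌋₊, Real.log y ^ 2 := by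
        refine sum_le_sum fun n hn => ?_
        obtain ⟨h1, h2⟩ := mem_Ioc.1 hn
        have hn0 : (1 : ℝ) ≤ n := by exact_mod_cast (Nat.zero_le _).trans_lt h1
        have := (Nat.le_floor_iff (by linarith)).1 h2
        have := Real.log_nonneg hn0
        gcongr
    _ = ((⌊y⌋₊ : ℝ) - ⌊x⌋₊) * Real.log y ^ 2 := by
        rw [sum_const, Nat.card_Ioc, nsmul_eq_mul, Nat.cast_sub hfl]
    _ ≤ _ := by
        gcongr
        have := Nat.floor_le (by linarith : 0 ≤ y)
        have := Nat.lt_floor_add_one x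
        linarith

lemma exists_abs_sum_log_sq_le : ∃ C : ℝ, 0 < C ∧ ∀ x : ℝ, Real.exp 2 ≤ x →
    |∑ n ∈ Ioc 0 ⌊x⌋₊, (ArithmeticFunction.vonMangoldt n - 1) * Real.log n ^ 2| ≤
      C * (x * Real.log x) := by
  obtain ⟨C, hC, h⟩ := exists_abs_sum_mul_log_le
  set a : ℕ → ℝ := fun n => ArithmeticFunction.vonMangoldt n * Real.log n ^ 2
  set b : ℕ → ℝ := fun n => Real.log n ^ 2
  have ha : ∀ n, 0 ≤ a n := fun n =>
    mul_nonneg ArithmeticFunction.vonMangoldt_nonneg (sq_nonneg _)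
  have hb : ∀ n, 0 ≤ b n := fun n => sq_nonneg _
  have hT : ∀ x : ℝ, Real.exp 1 ≤ x → |∑ n ∈ Ioc 0 ⌊x⌋₊, a n * Real.log (x / n) -
      ∑ n ∈ Ioc 0 ⌊x⌋₊, b n * Real.log (x / n)| ≤ C * x := by
    intro x hx
    rw [← sum_sub_distrib]
    refine le_of_eq_of_le ?_ (h x hx)
    congr 1
    refine sum_congr rfl fun n _ => ?_
    simp only [a, b]
    ring
  refine ⟨8 + 6 * C, by positivity, fun x hx => ?_⟩
  have he : Real.exp 2 = Real.exp 1 * Real.exp 1 := by rw [← Real.exp_add]; norm_num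
  have he2 : 2 ≤ Real.exp 1 := by linarith [Real.add_one_le_exp (1 : ℝ)]
  have hx0 : 0 < x := (Real.exp_pos 2).trans_le hx
  have hx4 : 2 * Real.exp 1 ≤ x := by nlinarith
  have hL : 2 ≤ Real.log x := by rwa [Real.le_log_iff_exp_le hx0]
  have hLx : Real.log x ≤ x := (Real.log_le_sub_one_of_pos hx0).trans (by linarith)
  set L := Real.log x
  set δ := 1 / L with hδ
  have hδ0 : 0 < δ := by positivity
  have hδ1 : δ ≤ 1 := by rw [hδ, div_le_one (by linarith)]; linarith
  have hδL : δ * L = 1 := by rw [hδ]; field_simp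
  set l := Real.log (1 + δ)
  have hl : δ / 2 ≤ l := by
    have h1 := Real.one_sub_inv_le_log_of_pos (by linarith : 0 < 1 + δ)
    refine le_trans ?_ h1
    have : 1 - (1 + δ)⁻¹ = δ / (1 + δ) := by field_simp; ring
    rw [this]
    gcongr
    linarith
  have hl0 : 0 < l := lt_of_lt_of_le (by positivity) hl
  have hlL : 1 / 2 ≤ l * L := by nlinarith
  have hS : ∑ n ∈ Ioc 0 ⌊x⌋₊, (ArithmeticFunction.vonMangoldt n - 1) * Real.log n ^ 2 =
      ∑ n ∈ Ioc 0 ⌊x⌋₊, a n - ∑ n ∈ Ioc 0 ⌊x⌋₊, b n := by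
    rw [← sum_sub_distrib]
    exact sum_congr rfl fun n _ => by simp only [a, b]; ring
  have absorb : ∀ u E : ℝ, u * l ≤ E * l + 3 * C * x → u ≤ E + 6 * C * (x * L) := by
    intro u E hu
    have : 3 * C * x ≤ 6 * C * (x * L) * l := by
      have : 0 ≤ 6 * C * x := by positivity
      nlinarith
    exact le_of_mul_le_mul_right (by linarith) hl0
  rw [hS, abs_le]
  constructor
  · set x' := x / (1 + δ) with hx'
    have hx'0 : 0 < x' := by positivity
    have hx'x : x' ≤ x := div_le_self hx0.le (by linarith)
    have hx'e : Real.exp 1 ≤ x' := by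
      rw [hx', le_div_iff₀ (by linarith)]
      nlinarith [Real.exp_pos 1]
    have hquot : x / x' = 1 + δ := by rw [hx']; field_simp
    have h1 := (sum_mul_log_sub_bounds ha hx'0 hx'x).2
    have h2 := (sum_mul_log_sub_bounds hb hx'0 hx'x).1
    rw [hquot] at h1 h2
    have h3 := (abs_le.1 (hT x (by linarith))).1
    have h4 := (abs_le.1 (hT x' hx'e)).2
    have h5 := sum_Ioc_log_sq_le hx'0 hx'x
    have h6 : x - x' ≤ x * δ := by
      have : x - x' = x * δ / (1 + δ) := by rw [hx']; field_simp; ring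
      rw [this]
      exact div_le_self (by positivity) (by linarith)
    have h7 : C * x' ≤ C * x := by gcongr
    have h8 := absorb (∑ n ∈ Ioc 0 ⌊x'⌋₊, b n - ∑ n ∈ Ioc 0 ⌊x⌋₊, a n) 0 (by
      rw [sub_mul]
      have : 0 ≤ C * x := by positivity
      linarith)
    have h9 : (x - x' + 1) * L ^ 2 ≤ 8 * (x * L) := by
      calc (x - x' + 1) * L ^ 2 ≤ (x * δ + 1) * L ^ 2 := by gcongr
        _ = x * L * (δ * L) + L * L := by ring
        _ ≤ x * L * 1 + x * L := by rw [hδL]; gcongr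
        _ ≤ _ := by
          have : 0 ≤ x * L := by positivity
          linarith
    change _ - _ ≤ (x - x' + 1) * L ^ 2 at h5
    linarith
  · set y := x * (1 + δ) with hy
    have hxy : x ≤ y := le_mul_of_one_le_right hx0.le (by linarith)
    have hquot : y / x = 1 + δ := by rw [hy]; field_simp
    have h1 := (sum_mul_log_sub_bounds ha hx0 hxy).1
    have h2 := (sum_mul_log_sub_bounds hb hx0 hxy).2
    rw [hquot] at h1 h2
    have h3 := (abs_le.1 (hT x (by linarith))).1
    have h4 := (abs_le.1 (hT y (by linarith))).2
    have h5 := sum_Ioc_log_sq_le hx0 hxy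
    have h6 : y - x = x * δ := by rw [hy]; ring
    have hy2 : y ≤ 2 * x := by rw [hy]; nlinarith
    have h7 : C * y ≤ C * (2 * x) := by gcongr
    have h8 := absorb (∑ n ∈ Ioc 0 ⌊x⌋₊, a n) (∑ n ∈ Ioc 0 ⌊y⌋₊, b n) (by linarith)
    have hlogy : Real.log y ≤ 2 * L := by
      calc Real.log y ≤ Real.log (x ^ 2) := Real.log_le_log (by linarith) (by nlinarith)
        _ = 2 * L := by rw [Real.log_pow]; norm_num; rfl
    have hlogy0 : 0 ≤ Real.log y := Real.log_nonneg (by linarith)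
    have h9 : (y - x + 1) * Real.log y ^ 2 ≤ 8 * (x * L) := by
      rw [h6]
      calc (x * δ + 1) * Real.log y ^ 2 ≤ (x * δ + 1) * (2 * L) ^ 2 := by gcongr
        _ = 4 * (x * L * (δ * L)) + 4 * (L * L) := by ring
        _ ≤ 4 * (x * L * 1) + 4 * (x * L) := by rw [hδL]; gcongr
        _ = _ := by ring
    change _ - _ ≤ (y - x + 1) * Real.log y ^ 2 at h5
    linarith

lemma exists_sum_vonMangoldt_add_one_le : ∃ K : ℝ, 0 < K ∧ ∀ x : ℝ, 0 < x →
    ∑ n ∈ Ioc 0 ⌊x⌋₊, (ArithmeticFunction.vonMangoldt n + 1) * Real.log (x / n) ≤ K * x := by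
  have hlog4 : 0 < Real.log 4 := Real.log_pos (by norm_num)
  have hw : ∀ n : ℕ, 0 ≤ ArithmeticFunction.vonMangoldt n + 1 := fun n =>
    add_nonneg ArithmeticFunction.vonMangoldt_nonneg zero_le_one
  set K := Real.log 4 + 5 with hK
  have hV : ∀ x : ℝ, 0 < x → ∑ n ∈ Ioc 0 ⌊x⌋₊, (ArithmeticFunction.vonMangoldt n + 1) ≤ K * x := by
    intro x hx
    have h1 := Chebyshev.psi_le_const_mul_self hx.le
    have h2 := Nat.floor_le hx.le
    rw [Chebyshev.psi] at h1
    rw [sum_add_distrib, sum_const, Nat.card_Ioc, nsmul_eq_mul, mul_one, hK, Nat.sub_zero]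
    linarith
  refine ⟨2 * K, by positivity, fun x hx => ?_⟩
  obtain ⟨k, hk⟩ := pow_unbounded_of_one_lt x (by norm_num : (1 : ℝ) < 2)
  induction k generalizing x with
  | zero =>
    rw [pow_zero] at hk
    rw [Nat.floor_eq_zero.2 hk]
    simp
    positivity
  | succ k ih =>
    have h1 := (sum_mul_log_sub_bounds hw (half_pos hx) (half_le_self hx.le)).2
    have h2 := ih (x / 2) (half_pos hx) (by rw [pow_succ] at hk; linarith)
    have h3 : x / (x / 2) = 2 := by field_simp
    rw [h3] at h1
    have h4 := hV x hx
    have h5 : (∑ n ∈ Ioc 0 ⌊x⌋₊, (ArithmeticFunction.vonMangoldt n + 1)) * Real.log 2 ≤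
        K * x * 1 := by
      gcongr
      linarith [Real.log_two_lt_d9]
    linarith

lemma exists_abs_psi_sub_le : ∃ C : ℝ, 0 < C ∧ ∀ x : ℝ, Real.exp 2 ≤ x →
    |Chebyshev.psi x - x| ≤ C * (x / Real.log x) := by
  obtain ⟨C, hC, h⟩ := exists_abs_sum_log_sq_le
  obtain ⟨K, hK, hD⟩ := exists_sum_vonMangoldt_add_one_le
  refine ⟨2 * K + C + 1, by positivity, fun x hx => ?_⟩
  have hx0 : 0 < x := (Real.exp_pos 2).trans_le hx
  have hL : 2 ≤ Real.log x := by rwa [Real.le_log_iff_exp_le hx0]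
  have hLx : Real.log x ≤ x := (Real.log_le_sub_one_of_pos hx0).trans (by linarith)
  have h1 := h x hx
  have h2 := hD x hx0
  set L := Real.log x with hLdef
  set M := ∑ n ∈ Ioc 0 ⌊x⌋₊, (ArithmeticFunction.vonMangoldt n - 1) with hM
  have h3 : |M * L ^ 2 - ∑ n ∈ Ioc 0 ⌊x⌋₊, (ArithmeticFunction.vonMangoldt n - 1) *
      Real.log n ^ 2| ≤ 2 * L * (K * x) := by
    rw [hM, sum_mul, ← sum_sub_distrib]
    refine (abs_sum_le_sum_abs _ _).trans (le_trans ?_ (mul_le_mul_of_nonneg_left h2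
      (by positivity)))
    rw [mul_sum]
    refine sum_le_sum fun n hn => ?_
    obtain ⟨n1, n2⟩ := mem_Ioc.1 hn
    have hn1 : (1 : ℝ) ≤ n := by exact_mod_cast n1
    have hnx := (Nat.le_floor_iff hx0.le).1 n2
    have hlogn := Real.log_nonneg hn1
    have hlogn' : Real.log n ≤ L := Real.log_le_log (by linarith) hnx
    have hΛ : |ArithmeticFunction.vonMangoldt n - 1| ≤ ArithmeticFunction.vonMangoldt n + 1 := by
      have : 0 ≤ ArithmeticFunction.vonMangoldt n := ArithmeticFunction.vonMangoldt_nonneg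
      rw [abs_le]
      constructor <;> linarith
    have e : (ArithmeticFunction.vonMangoldt n - 1) * L ^ 2 -
        (ArithmeticFunction.vonMangoldt n - 1) * Real.log n ^ 2 =
        (ArithmeticFunction.vonMangoldt n - 1) * ((L - Real.log n) * (L + Real.log n)) := by ring
    rw [e, abs_mul, abs_of_nonneg (a := (L - Real.log n) * (L + Real.log n))
        (mul_nonneg (by linarith) (by linarith)),
      Real.log_div hx0.ne' (by linarith)]
    have h0 : 0 ≤ L - Real.log n := by linarith
    calc |ArithmeticFunction.vonMangoldt n - 1| * ((L - Real.log n) * (L + Real.log n))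
        ≤ (ArithmeticFunction.vonMangoldt n + 1) * ((L - Real.log n) * (L + L)) := by gcongr
      _ = _ := by ring
  have h4 : |M| * L ^ 2 ≤ (2 * K + C) * (x * L) := by
    calc |M| * L ^ 2 = |M * L ^ 2| := by rw [abs_mul, abs_of_nonneg (sq_nonneg L)]
      _ ≤ 2 * L * (K * x) + C * (x * L) := by
        have := abs_sub_abs_le_abs_sub (M * L ^ 2) (∑ n ∈ Ioc 0 ⌊x⌋₊,
          (ArithmeticFunction.vonMangoldt n - 1) * Real.log n ^ 2)
        linarith
      _ = _ := by ring
  have h5 : |M| ≤ (2 * K + C) * (x / L) := by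
    refine le_of_mul_le_mul_right (h4.trans_eq ?_) (by positivity : 0 < L ^ 2)
    field_simp
  have h6 : Chebyshev.psi x - x = M + (⌊x⌋₊ - x) := by
    rw [hM, sum_sub_distrib, Chebyshev.psi, sum_const, Nat.card_Ioc, nsmul_eq_mul, mul_one,
      Nat.sub_zero]
    ring
  have h7 : |(⌊x⌋₊ : ℝ) - x| ≤ x / L := by
    have a := Nat.floor_le hx0.le
    have b := Nat.lt_floor_add_one x
    have c : 1 ≤ x / L := by rwa [one_le_div (by linarith)]
    rw [abs_le]
    constructor <;> linarith
  rw [h6]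
  refine (abs_add_le _ _).trans ?_
  linarith

lemma summable_pow_div_two_pow (r : ℕ) : Summable fun j : ℕ => ((j : ℝ) + 1) ^ (2 * r) / 2 ^ j := by
  have h := (summable_nat_add_iff (f := fun j : ℕ => (j : ℝ) ^ (2 * r) * (1 / 2) ^ j) 1).2
    (summable_pow_mul_geometric_of_norm_lt_one (2 * r) (by norm_num : ‖(1 / 2 : ℝ)‖ < 1))
  refine (h.mul_left 2).congr fun j => ?_
  rw [pow_succ (1 / 2 : ℝ), one_div, inv_pow]
  push_cast
  field_simp

lemma exists_tsum_ratio_bounds (r : ℕ) : ∃ C : ℝ, 0 < C ∧ ∀ (τ v : ℕ → ℝ) (p : ℝ), 2 ≤ p →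
    τ 0 = 1 → v 0 = 1 → τ 1 = r → (∀ m, 0 ≤ τ m) → (∀ m, 0 ≤ v m) →
    (∀ m, τ m ≤ ((m : ℝ) + 1) ^ r) → (∀ m, v m ≤ ((m : ℝ) + 1) ^ r) →
    (∀ e : ℕ, |(∑' j, τ (e + j) * v j / p ^ j) / ∑' j, τ j * v j / p ^ j| ≤
      C * ((e : ℝ) + 1) ^ r) ∧
    |(∑' j, τ (1 + j) * v j / p ^ j) / (∑' j, τ j * v j / p ^ j) - r| ≤ C / p := by
  set u : ℕ → ℝ := fun j => ((j : ℝ) + 1) ^ (2 * r) / 2 ^ j with hu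
  have hus : Summable u := summable_pow_div_two_pow r
  have hu0 : ∀ j, 0 ≤ u j := fun j => by positivity
  set C₀ := ∑' j, u j with hC
  have hC₀ : 1 ≤ C₀ := by
    refine le_trans ?_ (hus.le_tsum 0 fun j _ => hu0 j)
    simp [hu]
  refine ⟨2 * (2 ^ r + r) * C₀, by positivity, fun τ v p hp τ0 v0 τ1 hτ hv hτr hvr => ?_⟩
  have hp0 : 0 < p := by linarith
  have hterm : ∀ e j : ℕ, τ (e + j) * v j / p ^ j ≤ ((e : ℝ) + 1) ^ r * u j := by
    intro e j
    calc τ (e + j) * v j / p ^ j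
        ≤ (((e + j : ℕ) : ℝ) + 1) ^ r * ((j : ℝ) + 1) ^ r / 2 ^ j := by
          have := hv j
          gcongr
          · exact hτr _
          · exact hvr j
      _ ≤ (((e : ℝ) + 1) * ((j : ℝ) + 1)) ^ r * ((j : ℝ) + 1) ^ r / 2 ^ j := by
          gcongr
          push_cast
          have : (0 : ℝ) ≤ e * j := by positivity
          linarith
      _ = _ := by rw [hu, mul_pow]; ring
  have hnn : ∀ e j : ℕ, 0 ≤ τ (e + j) * v j / p ^ j := fun e j =>
    div_nonneg (mul_nonneg (hτ _) (hv j)) (by positivity)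
  have hsum : ∀ e : ℕ, Summable fun j => τ (e + j) * v j / p ^ j := fun e =>
    .of_nonneg_of_le (hnn e) (hterm e) (hus.mul_left _)
  have hsum0 : Summable fun j => τ j * v j / p ^ j := by simpa using hsum 0
  have hD : 1 ≤ ∑' j, τ j * v j / p ^ j := by
    refine le_trans ?_ (hsum0.le_tsum 0 fun j _ => by simpa using hnn 0 j)
    simp [τ0, v0]
  set D := ∑' j, τ j * v j / p ^ j
  have hD0 : 0 < D := by linarith
  have h2r : (1 : ℝ) ≤ 2 * (2 ^ r + r) := by
    have : (1 : ℝ) ≤ 2 ^ r := one_le_pow₀ (by norm_num)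
    have : (0 : ℝ) ≤ r := by positivity
    linarith
  refine ⟨fun e => ?_, ?_⟩
  · rw [abs_of_nonneg (div_nonneg (tsum_nonneg (hnn e)) hD0.le)]
    calc (∑' j, τ (e + j) * v j / p ^ j) / D ≤ ∑' j, τ (e + j) * v j / p ^ j :=
          div_le_self (tsum_nonneg (hnn e)) hD
      _ ≤ ∑' j, ((e : ℝ) + 1) ^ r * u j := (hsum e).tsum_le_tsum (hterm e) (hus.mul_left _)
      _ = 1 * C₀ * ((e : ℝ) + 1) ^ r := by rw [tsum_mul_left]; ring
      _ ≤ _ := by gcongr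
  · rw [div_sub' hD0.ne', abs_div, abs_of_pos hD0]
    refine (div_le_self (abs_nonneg _) hD).trans ?_
    rw [mul_comm D, ← tsum_mul_left, ← (hsum 1).tsum_sub (hsum0.mul_left _), ← Real.norm_eq_abs]
    have hb : ∀ j : ℕ, ‖τ (1 + j) * v j / p ^ j - r * (τ j * v j / p ^ j)‖ ≤
        2 * (2 ^ r + r) / p * u j := by
      intro j
      rcases j with _ | j
      · have := hu0 0
        simp only [add_zero, τ1, v0, τ0]
        simp
        positivity
      · have hpj : (2 : ℝ) ^ j ≤ p ^ j := by gcongr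
        have h1 : τ (1 + (j + 1)) * v (j + 1) ≤ 2 ^ r * (((j + 1 : ℕ) : ℝ) + 1) ^ (2 * r) := by
          calc τ (1 + (j + 1)) * v (j + 1)
              ≤ (2 * (((j + 1 : ℕ) : ℝ) + 1)) ^ r * (((j + 1 : ℕ) : ℝ) + 1) ^ r := by
                refine mul_le_mul ((hτr _).trans ?_) (hvr _) (hv _) (by positivity)
                gcongr
                push_cast
                linarith [(Nat.cast_nonneg j : (0 : ℝ) ≤ j)]
            _ = _ := by rw [mul_pow]; ring
        have h2 : τ (j + 1) * v (j + 1) ≤ (((j + 1 : ℕ) : ℝ) + 1) ^ (2 * r) := by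
          rw [two_mul, pow_add]
          exact mul_le_mul (hτr _) (hvr _) (hv _) (by positivity)
        have h3 : 0 ≤ τ (1 + (j + 1)) * v (j + 1) := mul_nonneg (hτ _) (hv _)
        have h4 : 0 ≤ τ (j + 1) * v (j + 1) := mul_nonneg (hτ _) (hv _)
        calc ‖τ (1 + (j + 1)) * v (j + 1) / p ^ (j + 1) -
              r * (τ (j + 1) * v (j + 1) / p ^ (j + 1))‖
            = |τ (1 + (j + 1)) * v (j + 1) - r * (τ (j + 1) * v (j + 1))| / p ^ (j + 1) := by
              rw [← mul_div_assoc, ← sub_div, Real.norm_eq_abs, abs_div,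
                abs_of_pos (pow_pos hp0 _)]
          _ ≤ ((2 ^ r + r) * (((j + 1 : ℕ) : ℝ) + 1) ^ (2 * r)) / (2 ^ j * p) := by
              rw [pow_succ]
              gcongr
              rw [add_mul]
              refine (abs_sub _ _).trans ?_
              rw [abs_of_nonneg h3, abs_of_nonneg (by positivity)]
              gcongr
          _ = _ := by simp only [hu]; rw [pow_succ (2 : ℝ) j]; field_simp
    refine (tsum_of_norm_bounded (hus.mul_left _).hasSum hb).trans ?_
    rw [tsum_mul_left]
    exact le_of_eq (by ring)

lemma tauR_succ (r n : ℕ) : tauR (r + 1) n = ∑ d ∈ n.divisors, tauR r d := by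
  simp only [tauR, pow_succ, ArithmeticFunction.mul_zeta_apply]

lemma tauR_one (r : ℕ) : tauR r 1 = 1 := by
  induction r with
  | zero => simp [tauR]
  | succ r ih => simp [tauR_succ, ih]

lemma tauR_prime (r : ℕ) {p : ℕ} (hp : p.Prime) : tauR r p = r := by
  induction r with
  | zero => simp [tauR, hp.ne_one]
  | succ r ih => rw [tauR_succ, hp.sum_divisors, ih, tauR_one]

lemma tauR_prime_pow_le (r : ℕ) {p : ℕ} (hp : p.Prime) (m : ℕ) : tauR r (p ^ m) ≤ (m + 1) ^ r := by
  induction r generalizing m with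
  | zero =>
    simp only [tauR, pow_zero, ArithmeticFunction.one_apply]
    split_ifs <;> simp
  | succ r ih =>
    rw [tauR_succ, Nat.sum_divisors_prime_pow hp]
    calc ∑ k ∈ range (m + 1), tauR r (p ^ k) ≤ ∑ k ∈ range (m + 1), (m + 1) ^ r := by
          refine sum_le_sum fun k hk => (ih k).trans ?_
          have := mem_range.1 hk
          gcongr
          omega
      _ = _ := by simp; ring

lemma exists_local_bounds (r : ℕ) {f : ℕ → ℝ} (hf : f = fOne r ∨ f = fTwo r) :
    ∃ C : ℝ, 0 < C ∧ ∀ p : ℕ, p.Prime →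
      |f p - r| ≤ C / p ∧ ∀ k : ℕ, k ≠ 0 → |f (p ^ k)| ≤ C * ((k : ℝ) + 1) ^ r := by
  obtain ⟨C, hC, h⟩ := exists_tsum_ratio_bounds r
  refine ⟨C, hC, fun p hp => ?_⟩
  have hp2 : (2 : ℝ) ≤ p := by exact_mod_cast hp.two_le
  have hτ : ∀ m : ℕ, (tauR r (p ^ m) : ℝ) ≤ ((m : ℝ) + 1) ^ r := fun m => by
    exact_mod_cast tauR_prime_pow_le r hp m
  have h0 : ∀ m : ℕ, (0 : ℝ) ≤ (tauR r (p ^ m) : ℝ) := fun m => Nat.cast_nonneg _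
  have key : ∀ v : ℕ → ℝ, v 0 = 1 → (∀ m, 0 ≤ v m) → (∀ m, v m ≤ ((m : ℝ) + 1) ^ r) →
      (∀ k : ℕ, k ≠ 0 → f (p ^ k) = (∑' j, (tauR r (p ^ (k + j)) : ℝ) * v j / (p : ℝ) ^ j) /
        ∑' j, (tauR r (p ^ j) : ℝ) * v j / (p : ℝ) ^ j) →
      |f p - r| ≤ C / p ∧ ∀ k : ℕ, k ≠ 0 → |f (p ^ k)| ≤ C * ((k : ℝ) + 1) ^ r := by
    intro v v0 hv hvr hfv
    obtain ⟨h1, h2⟩ := h (fun m => tauR r (p ^ m)) v p hp2 (by simp [tauR_one]) v0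
      (by simp [tauR_prime r hp]) h0 hv hτ hvr
    refine ⟨?_, fun k hk => ?_⟩
    · have := hfv 1 one_ne_zero
      rw [pow_one] at this
      rw [this]
      exact h2
    · rw [hfv k hk]
      exact h1 k
  rcases hf with rfl | rfl
  · refine key (fun _ => 1) rfl (fun _ => zero_le_one) (fun m => one_le_pow₀ ?_) fun k hk => ?_
    · linarith [(Nat.cast_nonneg m : (0 : ℝ) ≤ m)]
    · simp [fOne, Nat.primeFactors_prime_pow hk hp, hp.factorization_self]
  · refine key (fun m => tauR r (p ^ m)) (by simp [tauR_one]) h0 hτ fun k hk => ?_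
    simp [fTwo, Nat.primeFactors_prime_pow hk hp, hp.factorization_self, sq]

lemma sum_vonMangoldt_div_le {x : ℝ} (hx : 1 ≤ x) :
    ∑ n ∈ Ioc 0 ⌊x⌋₊, ArithmeticFunction.vonMangoldt n / n ≤
      Real.log x * (1 + Real.log x) := by
  calc ∑ n ∈ Ioc 0 ⌊x⌋₊, ArithmeticFunction.vonMangoldt n / (n : ℝ)
      ≤ ∑ n ∈ Ioc 0 ⌊x⌋₊, Real.log x * (n : ℝ)⁻¹ := by
        refine sum_le_sum fun n hn => ?_
        obtain ⟨h1, h2⟩ := mem_Ioc.1 hn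
        have hn0 : (0 : ℝ) < n := by exact_mod_cast h1
        have := (Nat.le_floor_iff (by linarith)).1 h2
        rw [← div_eq_mul_inv]
        gcongr
        exact ArithmeticFunction.vonMangoldt_le_log.trans (Real.log_le_log hn0 this)
    _ = Real.log x * harmonic ⌊x⌋₊ := by
        rw [← mul_sum, harmonic_eq_sum_Icc]
        push_cast
        rfl
    _ ≤ _ := by
        gcongr
        · exact Real.log_nonneg hx
        · exact harmonic_floor_le_one_add_log x hx

lemma abs_sum_vonMangoldt_mul_sub_le {r : ℕ} {f : ℕ → ℝ} {C : ℝ} (hC : 0 < C)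
    (hf : ∀ p : ℕ, p.Prime →
      |f p - r| ≤ C / p ∧ ∀ k : ℕ, k ≠ 0 → |f (p ^ k)| ≤ C * ((k : ℝ) + 1) ^ r)
    {x : ℝ} (hx : Real.exp 1 ≤ x) :
    |∑ n ∈ Ioc 0 ⌊x⌋₊, ArithmeticFunction.vonMangoldt n * f n - r * Chebyshev.psi x| ≤
      C * (Real.log x * (1 + Real.log x)) +
        (C * (3 * Real.log x) ^ r + r) * (2 * √x * Real.log x) := by
  have hx0 : 0 < x := (Real.exp_pos 1).trans_le hx
  have hx1 : 1 ≤ x := by linarith [Real.add_one_le_exp (1 : ℝ)]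
  have hL : 1 ≤ Real.log x := by rwa [Real.le_log_iff_exp_le hx0]
  set L := Real.log x with hLdef
  set B := C * (3 * L) ^ r + r with hB
  have hB0 : 0 ≤ B := by positivity
  rw [Chebyshev.psi, mul_sum, ← sum_sub_distrib]
  refine (abs_sum_le_sum_abs _ _).trans ?_
  calc ∑ n ∈ Ioc 0 ⌊x⌋₊,
        |ArithmeticFunction.vonMangoldt n * f n - r * ArithmeticFunction.vonMangoldt n|
      ≤ ∑ n ∈ Ioc 0 ⌊x⌋₊, (C * (ArithmeticFunction.vonMangoldt n / n) +
          if ¬ n.Prime then B * ArithmeticFunction.vonMangoldt n else 0) := by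
        refine sum_le_sum fun n hn => ?_
        obtain ⟨n1, n2⟩ := mem_Ioc.1 hn
        have hnx := (Nat.le_floor_iff hx0.le).1 n2
        have hΛ : 0 ≤ ArithmeticFunction.vonMangoldt n := ArithmeticFunction.vonMangoldt_nonneg
        rw [mul_comm (r : ℝ), ← mul_sub, abs_mul, abs_of_nonneg hΛ]
        by_cases hp : n.Prime
        · rw [if_neg (not_not.2 hp), add_zero]
          refine (mul_le_mul_of_nonneg_left (hf n hp).1 hΛ).trans_eq ?_
          ring
        · rw [if_pos hp]
          refine le_add_of_nonneg_of_le (by positivity) ?_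
          by_cases hpp : IsPrimePow n
          · obtain ⟨p, k, hp', hk, rfl⟩ := (isPrimePow_nat_iff n).1 hpp
            rw [mul_comm B]
            refine mul_le_mul_of_nonneg_left ?_ hΛ
            have hk3 : (k : ℝ) + 1 ≤ 3 * L := by
              have h1 : k * Real.log 2 ≤ L := by
                rw [← Real.log_pow]
                refine Real.log_le_log (by positivity) (le_trans ?_ hnx)
                have : 2 ^ k ≤ p ^ k := Nat.pow_le_pow_left hp'.two_le k
                exact_mod_cast this
              have h2 := Real.log_two_gt_d9
              have h3 : (k : ℝ) * (1 / 2) ≤ k * Real.log 2 := by gcongr; linarith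
              linarith
            refine (abs_sub _ _).trans (add_le_add (((hf p hp').2 k hk.ne').trans ?_) ?_)
            · gcongr
            · rw [Nat.abs_cast]
          · rw [ArithmeticFunction.vonMangoldt_eq_zero_iff.2 hpp]
            simp
    _ = C * ∑ n ∈ Ioc 0 ⌊x⌋₊, ArithmeticFunction.vonMangoldt n / n +
          B * (Chebyshev.psi x - Chebyshev.theta x) := by
        rw [sum_add_distrib, ← mul_sum, ← sum_filter, ← mul_sum,
          Chebyshev.psi_sub_theta_eq_sum_not_prime]
    _ ≤ _ := by
        gcongr
        · exact sum_vonMangoldt_div_le hx1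
        · exact Chebyshev.psi_sub_theta_le hx1

/-- Fix `r ∈ ℕ` and let `i ∈ {1, 2}`. Then
`Σ_{n ≤ x} Λ(n) f_i(n) = r x (1 + O(1/log x))` as `x → ∞`, where `Λ` is the von Mangoldt
function. -/

theorem sum_vonMangoldt_mul_fi (r : ℕ) (hr : 1 ≤ r) (f : ℕ → ℝ)
    (hf : f = fOne r ∨ f = fTwo r) :
    (fun x : ℝ =>
        (∑ n ∈ Finset.Icc 1 ⌊x⌋₊, ArithmeticFunction.vonMangoldt n * f n) - r * x)
      =O[atTop] fun x : ℝ => r * x / Real.log x := by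
  obtain ⟨C, hC, hloc⟩ := exists_local_bounds r hf
  obtain ⟨K, hK, hψ⟩ := exists_abs_psi_sub_le
  refine Asymptotics.IsBigO.of_bound (2 * C + 2 * (C * 3 ^ r + r) + K) ?_
  filter_upwards [eventually_ge_atTop (Real.exp 2),
    (Real.isLittleO_pow_log_id_atTop (n := 3)).bound one_pos,
    (Real.isLittleO_pow_log_id_atTop (n := 2 * (r + 2))).bound one_pos] with x hx h3 h4
  have hx0 : 0 < x := (Real.exp_pos 2).trans_le hx
  have hL : 2 ≤ Real.log x := by rwa [Real.le_log_iff_exp_le hx0]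
  have h1 := abs_sum_vonMangoldt_mul_sub_le hC hloc
    ((Real.exp_le_exp.2 (by norm_num : (1 : ℝ) ≤ 2)).trans hx)
  have h2 := hψ x hx
  set L := Real.log x with hLdef
  have hL0 : 0 < L := by linarith
  simp only [id, Real.norm_eq_abs, one_mul, abs_of_pos hx0, abs_of_pos (pow_pos hL0 _)] at h3 h4
  have h5 : L ^ (r + 2) ≤ √x := Real.le_sqrt_of_sq_le (by rwa [← pow_mul, mul_comm])
  have h6 : C * (L * (1 + L)) + (C * (3 * L) ^ r + r) * (2 * √x * L) ≤
      (2 * C + 2 * (C * 3 ^ r + r)) * (x / L) := by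
    rw [← mul_div_assoc, le_div_iff₀ hL0]
    have hLr : 1 ≤ L ^ r := one_le_pow₀ (by linarith)
    calc (C * (L * (1 + L)) + (C * (3 * L) ^ r + r) * (2 * √x * L)) * L
        = C * (L ^ 2 * (1 + L)) + 2 * (C * 3 ^ r * L ^ r + r * 1) * (L ^ 2 * √x) := by
          rw [mul_pow]; ring
      _ ≤ C * (L ^ 2 * (L + L)) + 2 * (C * 3 ^ r * L ^ r + r * L ^ r) * (L ^ 2 * √x) := by
          gcongr
          linarith
      _ = 2 * C * L ^ 3 + 2 * (C * 3 ^ r + r) * (L ^ (r + 2) * √x) := by ring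
      _ ≤ 2 * C * x + 2 * (C * 3 ^ r + r) * (√x * √x) := by gcongr
      _ = _ := by rw [Real.mul_self_sqrt hx0.le]; ring
  have hr1 : (1 : ℝ) ≤ r := by exact_mod_cast hr
  have hxL : 0 < x / L := by positivity
  change |∑ n ∈ Icc (0 + 1) ⌊x⌋₊, ArithmeticFunction.vonMangoldt n * f n - r * x| ≤ _
  rw [Finset.Icc_add_one_left_eq_Ioc, Real.norm_eq_abs, mul_div_assoc,
    abs_of_nonneg (a := r * (x / L)) (by positivity)]
  have e : ∑ n ∈ Ioc 0 ⌊x⌋₊, ArithmeticFunction.vonMangoldt n * f n - r * x =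
      (∑ n ∈ Ioc 0 ⌊x⌋₊, ArithmeticFunction.vonMangoldt n * f n - r * Chebyshev.psi x) +
        r * (Chebyshev.psi x - x) := by ring
  rw [e]
  calc |(∑ n ∈ Ioc 0 ⌊x⌋₊, ArithmeticFunction.vonMangoldt n * f n - r * Chebyshev.psi x) +
        r * (Chebyshev.psi x - x)|
      ≤ (2 * C + 2 * (C * 3 ^ r + r)) * (x / L) + r * (K * (x / L)) := by
        refine (abs_add_le _ _).trans (add_le_add (h1.trans h6) ?_)
        rw [abs_mul, Nat.abs_cast]
        gcongr
    _ ≤ (2 * C + 2 * (C * 3 ^ r + r)) * (r * (x / L)) + r * (K * (x / L)) := by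
        gcongr
        exact le_mul_of_one_le_left hxL.le hr1
    _ = _ := by ring
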